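/- arXiv:2405.17415 — 2 statements merged into one kernel-verified Lean document; each statement's English description precedes it below -/
import Mathlib

section
/- Let ω be a germ of holomorphic (n−2)-form at 0 ∈ ℂ^n with ω(0) = 0, defining a germ of singular two-dimensional distribution with locally free tangent sheaf, and let X be a germ of holomorphic vector field at 0 with i_X ω = 0. If rank(DX(0)) ≥ 2, then X divides ω, i.e. there is a germ of holomorphic (n−1)-form Θ at 0 with ω = i_X Θ. -/
open Topology Filter Set
open scoped ENNReal Manifold

noncomputable section

/-- `ℂⁿ`. -/
abbrev Cn (n : ℕ) : Type := Fin n → ℂ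

/-- Holomorphic `m`-forms on (open subsets of) `ℂⁿ`, as alternating-map valued functions. -/
abbrev Form (n m : ℕ) : Type := Cn n → AlternatingMap ℂ (Cn n) ℂ (Fin m)

/-- Vector fields on (open subsets of) `ℂⁿ`. -/
abbrev VF (n : ℕ) : Type := Cn n → Cn n

/-- A form is holomorphic on `U` if all its coefficient functions are. -/
def HolFormOn {n m : ℕ} (U : Set (Cn n)) (ω : Form n m) : Prop :=
  ∀ v : Fin m → Cn n, AnalyticOnNhd ℂ (fun z => ω z v) U

/-- A form is holomorphic at (a neighborhood of) a point `c`. -/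
def HolFormAt {n m : ℕ} (c : Cn n) (ω : Form n m) : Prop :=
  ∀ v : Fin m → Cn n, AnalyticAt ℂ (fun z => ω z v) c

/-- The zero locus (singular set) of a form. -/
def zeroLocus {n m : ℕ} (ω : Form n m) : Set (Cn n) := {z | ω z = 0}

/-- `V ⊆ ℂⁿ` has (complex) codimension at least `c`; via Hausdorff dimension
(a complex-analytic set of complex dimension `d` has Hausdorff dimension `2d`).
The empty set has codimension `≥ c` for every `c`. -/
def CodimGE (n : ℕ) (V : Set (Cn n)) (c : ℕ) : Prop :=
  V = ∅ ∨ dimH V + 2 * (c : ℝ≥0∞) ≤ 2 * (n : ℝ≥0∞)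

/-- The germ of `V` at `c` has codimension at least `k`. -/
def GermCodimGE (n : ℕ) (c : Cn n) (V : Set (Cn n)) (k : ℕ) : Prop :=
  ∃ U ∈ 𝓝 c, CodimGE n (V ∩ U) k

/-- `i_X (ω) = 0` at the point `z` : the form `ω` annihilates the vector `X z` at `z`. -/
def TangentAt {n m : ℕ} (ω : Form n m) (X : VF n) (z : Cn n) : Prop :=
  ∀ (v : Fin m → Cn n) (i : Fin m), v i = X z → ω z v = 0

/-- `ω` is locally decomposable (as a wedge of holomorphic `1`-forms) at the points
of `U` where it does not vanish. -/
def LocallyDecomp {n m : ℕ} (U : Set (Cn n)) (ω : Form n m) : Prop :=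
  ∀ z ∈ U, ω z ≠ 0 → ∃ W ∈ 𝓝 z, W ⊆ U ∧ ∃ η : Fin m → Cn n → (Cn n →ₗ[ℂ] ℂ),
    (∀ i (v : Cn n), AnalyticOnNhd ℂ (fun w => η i w v) W) ∧
    ∀ w ∈ W, ∀ v : Fin m → Cn n, ω w v = Matrix.det (Matrix.of fun i j => η i w (v j))

/-- The rank of the derivative (linear part) of a vector field at a point. -/
def rkAt {n : ℕ} (X : VF n) (z : Cn n) : ℕ :=
  Module.finrank ℂ (LinearMap.range (fderiv ℂ X z).toLinearMap)

/-- The germ at `c` of the vector field `X` divides the germ of the `m`-form `ω`: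
`ω = i_X Θ` for some germ of holomorphic `(m+1)`-form `Θ`. -/
def DividesAt {n m : ℕ} (X : VF n) (ω : Form n m) (c : Cn n) : Prop :=
  ∃ Θ : Form n (m + 1), HolFormAt c Θ ∧
    ∀ᶠ z in 𝓝 c, ∀ v : Fin m → Cn n, ω z v = Θ z (Fin.cons (X z) v)

/-- The germ at `0` of an `m`-form defines a singular holomorphic distribution:
it is holomorphic, locally decomposable outside its zero set, and its zero set has
codimension at least two. -/
structure IsGermDist (n m : ℕ) (ω : Form n m) : Prop where
  hol : ∃ U ∈ 𝓝 (0 : Cn n), HolFormOn U ω ∧ LocallyDecomp U ω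
  codim : GermCodimGE n 0 (zeroLocus ω) 2

/-- The tangent sheaf of the germ of two-dimensional distribution defined by the
`m`-form `ω` (`m = n - 2`) is locally free: `ω = i_Y i_Z Θ` for germs of vector fields
`Y, Z` and a germ of `n`-form `Θ`. -/
def GermLocFree2 (n m : ℕ) (ω : Form n m) : Prop :=
  ∃ (Y Z : VF n) (Θ : Form n (m + 2)), AnalyticAt ℂ Y 0 ∧ AnalyticAt ℂ Z 0 ∧ HolFormAt 0 Θ ∧
    ∀ᶠ z in 𝓝 (0 : Cn n), ∀ v : Fin m → Cn n,
      ω z v = Θ z (Fin.cons (Y z) (Fin.cons (Z z) v))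

/-- `ω = i_X i_Y Θ` near `0`, for some germ of vector field `Y` and germ of `n`-form `Θ`. -/
def DivPairAt {n m : ℕ} (X : VF n) (ω : Form n m) : Prop :=
  ∃ (Y : VF n) (Θ : Form n (m + 2)), AnalyticAt ℂ Y 0 ∧ HolFormAt 0 Θ ∧
    ∀ᶠ z in 𝓝 (0 : Cn n), ∀ v : Fin m → Cn n,
      ω z v = Θ z (Fin.cons (X z) (Fin.cons (Y z) v))

/-- The tangent sheaf of the germ of `k`-dimensional distribution defined by the `m`-form
`ω` (`n = k + m`) is locally free: `ω = i_{X_1} ⋯ i_{X_k} Θ`. -/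
def GermLocFreeK (n k m : ℕ) (h : n = k + m) (ω : Form n m) : Prop :=
  ∃ (Xs : Fin k → VF n) (Θ : Form n n), (∀ i, AnalyticAt ℂ (Xs i) 0) ∧ HolFormAt 0 Θ ∧
    ∀ᶠ z in 𝓝 (0 : Cn n), ∀ v : Fin m → Cn n,
      ω z v = Θ z (fun i => Fin.append (fun a => Xs a z) v (Fin.cast h i))

/-- The germs at `c` of the vector fields `Xs` freely generate the germs of vector
fields tangent to the distribution defined by `ω` : every germ of tangent vector field
is a combination of the `Xs` with holomorphic coefficients, and the coefficients in such
combinations are unique (i.e. the `Xs` are independent over the local ring at `c`). -/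
def FreeGensAt {n m : ℕ} (ω : Form n m) {k : ℕ} (Xs : Fin k → VF n) (c : Cn n) : Prop :=
  (∀ Z : VF n, AnalyticAt ℂ Z c → (∀ᶠ z in 𝓝 c, TangentAt ω Z z) →
      ∃ f : Fin k → Cn n → ℂ, (∀ i, AnalyticAt ℂ (f i) c) ∧
        ∀ᶠ z in 𝓝 c, Z z = ∑ i, f i z • Xs i z) ∧
  (∀ f : Fin k → Cn n → ℂ, (∀ i, AnalyticAt ℂ (f i) c) →
      (∀ᶠ z in 𝓝 c, (∑ i, f i z • Xs i z) = 0) → ∀ i, ∀ᶠ z in 𝓝 c, f i z = 0)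

/-- Polydiscs in `ℂⁿ`. -/
def IsPolydisc {n : ℕ} (U : Set (Cn n)) : Prop :=
  ∃ (c : Cn n) (r : Fin n → ℝ), (∀ i, 0 < r i) ∧ U = {z | ∀ i, dist (z i) (c i) < r i}

/-- The wedge product of a `1`-form with a `k`-form, as a function of `k+1` vectors. -/
def wedge1 {n k : ℕ} (ω : Form n 1) (α : Form n k) (z : Cn n) (v : Fin (k + 1) → Cn n) : ℂ :=
  ∑ i : Fin (k + 1), (-1 : ℂ) ^ (i : ℕ) * ω z (fun _ => v i) * α z (fun j => v (i.succAbove j))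

/-! ### Analytic subsets of open sets of `ℂᴺ`, irreducibility, components -/

/-- `V` is an analytic subset of `U`: locally (on `U`) it is the common zero set of
finitely many holomorphic functions. -/
def IsAnalyticIn {N : ℕ} (U V : Set (Cn N)) : Prop :=
  V ⊆ U ∧ ∀ p ∈ U, ∃ W ∈ 𝓝 p, ∃ (r : ℕ) (f : Fin r → Cn N → ℂ),
    (∀ i, AnalyticOnNhd ℂ (f i) W) ∧ ∀ z ∈ W ∩ U, (z ∈ V ↔ ∀ i, f i z = 0)

/-- An irreducible analytic subset of `U`. -/
def IsIrredAnalyticIn {N : ℕ} (U V : Set (Cn N)) : Prop :=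
  IsAnalyticIn U V ∧ V.Nonempty ∧
    ∀ V1 V2, IsAnalyticIn U V1 → IsAnalyticIn U V2 → V = V1 ∪ V2 → V = V1 ∨ V = V2

/-- `C` is an irreducible component of the analytic set `V ⊆ U` : a maximal irreducible
analytic subset of `U` contained in `V`. -/
def IsIrredComponentIn {N : ℕ} (U V C : Set (Cn N)) : Prop :=
  IsIrredAnalyticIn U C ∧ C ⊆ V ∧ ∀ C', IsIrredAnalyticIn U C' → C ⊆ C' → C' ⊆ V → C' = C

/-! ### Distributions and foliations on `ℙⁿ`, in homogeneous coordinates -/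

/-- A `k`-dimensional singular holomorphic distribution of degree `d` on `ℙⁿ`, given in
homogeneous coordinates by a homogeneous `(n-k)`-form `ω` on `ℂⁿ⁺¹` (with polynomial
coefficients of degree `d+1`) satisfying `i_R ω = 0`, locally decomposable outside its
singular set, whose singular set has codimension at least `2`. -/
structure ProjDist (n k : ℕ) where
  d : ℕ
  ω : Form (n + 1) (n - k)
  hol : HolFormOn Set.univ ω
  homog : ∀ (t : ℂ) (z : Cn (n + 1)) (v : Fin (n - k) → Cn (n + 1)),
    ω (t • z) v = t ^ (d + 1) * ω z v
  radial : ∀ (z : Cn (n + 1)) (v : Fin (n - k) → Cn (n + 1)) (i : Fin (n - k)),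
    v i = z → ω z v = 0
  decomp : LocallyDecomp Set.univ ω
  codim : CodimGE (n + 1) {z | z ≠ 0 ∧ ω z = 0} 2

/-- The singular set of a distribution on `ℙⁿ`, as a cone in `ℂⁿ⁺¹ \ {0}`. -/
def ProjDist.coneSing {n k : ℕ} (D : ProjDist n k) : Set (Cn (n + 1)) :=
  {z | z ≠ 0 ∧ D.ω z = 0}

/-- A one-dimensional singular holomorphic foliation of degree `d` on `ℙⁿ`, given in
homogeneous coordinates by a homogeneous polynomial vector field on `ℂⁿ⁺¹`, whose
singular set (points where `V ∧ R = 0`) has codimension at least `2`. -/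
structure ProjFol1 (n : ℕ) where
  d : ℕ
  V : VF (n + 1)
  hol : AnalyticOnNhd ℂ V Set.univ
  homog : ∀ (t : ℂ) (z : Cn (n + 1)), V (t • z) = t ^ d • V z
  codim : CodimGE (n + 1) {z | z ≠ 0 ∧ V z ∈ Submodule.span ℂ {z}} 2

/-- The singular set of a one-dimensional foliation on `ℙⁿ`, as a cone in `ℂⁿ⁺¹ \ {0}`. -/
def ProjFol1.coneSing {n : ℕ} (G : ProjFol1 n) : Set (Cn (n + 1)) :=
  {z | z ≠ 0 ∧ G.V z ∈ Submodule.span ℂ {z}}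

/-- The foliation `G` is tangent to the distribution `D` : `i_V ω = 0`. -/
def PTangent {n k : ℕ} (G : ProjFol1 n) (D : ProjDist n k) : Prop :=
  ∀ (z : Cn (n + 1)) (v : Fin (n - k) → Cn (n + 1)) (i : Fin (n - k)),
    v i = G.V z → D.ω z v = 0

/-- `G` locally divides the two-dimensional distribution `D` at the point of `ℙⁿ`
corresponding to `q ∈ ℂⁿ⁺¹ \ {0}` : in homogeneous coordinates, `ω = i_V i_R Θ` near `q`
for some germ of holomorphic `(n-1)`-form `Θ` (equivalently, in an affine chart at `[q]`,
the defining vector field of `G` divides the defining form of `D`). -/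
def PLocDividesAt {n : ℕ} (G : ProjFol1 n) (D : ProjDist n 2) (q : Cn (n + 1)) : Prop :=
  ∃ Θ : Form (n + 1) (n - 2 + 2), HolFormAt q Θ ∧
    ∀ᶠ z in 𝓝 q, ∀ v : Fin (n - 2) → Cn (n + 1),
      D.ω z v = Θ z (Fin.cons (G.V z) (Fin.cons z v))

/-- The tangent sheaf of the two-dimensional distribution `D` on `ℙⁿ` is locally free:
near every point of `ℂⁿ⁺¹ \ {0}` one can write `ω = i_X i_Y i_R Θ`. -/
def PLocFreeAt {n : ℕ} (D : ProjDist n 2) (q : Cn (n + 1)) : Prop :=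
  ∃ (X Y : VF (n + 1)) (Θ : Form (n + 1) (n - 2 + 3)),
    AnalyticAt ℂ X q ∧ AnalyticAt ℂ Y q ∧ HolFormAt q Θ ∧
    ∀ᶠ z in 𝓝 q, ∀ v : Fin (n - 2) → Cn (n + 1),
      D.ω z v = Θ z (Fin.cons (X z) (Fin.cons (Y z) (Fin.cons z v)))

def PLocFree {n : ℕ} (D : ProjDist n 2) : Prop :=
  ∀ q : Cn (n + 1), q ≠ 0 → PLocFreeAt D q

/-- The linearization, at a singular point `q` (with `ℓ q = 1`), of the vector field
induced on the affine chart `{ℓ = 1}` of `ℙⁿ` by the homogeneous vector field `V`. -/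
def projLin {n : ℕ} (V : VF n) (q : Cn n) (ℓ : Cn n →ₗ[ℂ] ℂ) : Cn n →ₗ[ℂ] Cn n :=
  (fderiv ℂ V q).toLinearMap - LinearMap.smulRight (ℓ ∘ₗ (fderiv ℂ V q).toLinearMap) q
    - ℓ (V q) • LinearMap.id

/-- The linear rank of the one-dimensional foliation `G` on `ℙⁿ` is at least `r` :
at every singular point, the linearization of the vector field induced on an affine
chart has rank at least `r`. -/
def PLinRankGE {n : ℕ} (G : ProjFol1 n) (r : ℕ) : Prop :=
  ∀ q ∈ G.coneSing, ∃ ℓ : Cn (n + 1) →ₗ[ℂ] ℂ, ℓ q = 1 ∧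
    r ≤ Module.finrank ℂ (Submodule.map (projLin G.V q ℓ) (LinearMap.ker ℓ))

/-- `T_D = T_G ⊕ T_H` : in homogeneous coordinates,
`ω = c ⋅ i_{V_G} i_{V_H} i_R (dx_0 ∧ ⋯ ∧ dx_n)` for a nonzero constant `c`. -/
def SplitPair {n : ℕ} (hn : n + 1 = 3 + (n - 2)) (G H : ProjFol1 n) (D : ProjDist n 2) :
    Prop :=
  ∃ c : ℂ, c ≠ 0 ∧ ∀ (z : Cn (n + 1)) (v : Fin (n - 2) → Cn (n + 1)),
    D.ω z v = c * Matrix.det (Matrix.of fun i j =>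
      Fin.append ![G.V z, H.V z, z] v (Fin.cast hn i) j)

/-- The tangent sheaf of the two-dimensional distribution `D` on `ℙⁿ` splits as a direct
sum of two line bundles: `ω = c ⋅ i_{X_1} i_{X_2} i_R (dx_0 ∧ ⋯ ∧ dx_n)` for homogeneous
polynomial vector fields `X_1, X_2` on `ℂⁿ⁺¹`. -/
def PSplits {n : ℕ} (hn : n + 1 = 3 + (n - 2)) (D : ProjDist n 2) : Prop :=
  ∃ (X1 X2 : VF (n + 1)) (d1 d2 : ℕ) (c : ℂ), c ≠ 0 ∧
    AnalyticOnNhd ℂ X1 Set.univ ∧ AnalyticOnNhd ℂ X2 Set.univ ∧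
    (∀ (t : ℂ) (z : Cn (n + 1)), X1 (t • z) = t ^ d1 • X1 z) ∧
    (∀ (t : ℂ) (z : Cn (n + 1)), X2 (t • z) = t ^ d2 • X2 z) ∧
    ∀ (z : Cn (n + 1)) (v : Fin (n - 2) → Cn (n + 1)),
      D.ω z v = c * Matrix.det (Matrix.of fun i j =>
        Fin.append ![X1 z, X2 z, z] v (Fin.cast hn i) j)

/-- The coefficient of the exterior differential of a `1`-form: `dω(a,b)` at `z`. -/
def extd1 {N : ℕ} (ω : Form N 1) (z a b : Cn N) : ℂ :=
  fderiv ℂ (fun y => ω y ![b]) z a - fderiv ℂ (fun y => ω y ![a]) z b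

/-- The Frobenius integrability condition `ω ∧ dω = 0` for a `1`-form. -/
def Integrable1 {N : ℕ} (ω : Form N 1) : Prop :=
  ∀ z a b c : Cn N,
    ω z ![a] * extd1 ω z b c + ω z ![b] * extd1 ω z c a + ω z ![c] * extd1 ω z a b = 0

/-! ### Distributions and foliations on complex manifolds -/

section Manifold

variable {n k : ℕ} {M : Type*} [TopologicalSpace M] [ChartedSpace (Cn n) M]

/-- A `k`-dimensional singular holomorphic distribution on a complex `n`-manifold `M`:
around each point it is given, in the chart at that point, by a holomorphic `(n-k)`-form,
locally decomposable outside its zero set, with zero set of codimension at least 2;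
on overlaps the local forms agree up to a nonvanishing holomorphic factor. -/
structure MDist (n k : ℕ) (M : Type*) [TopologicalSpace M] [ChartedSpace (Cn n) M] where
  ω : M → Form n (n - k)
  dom : M → Set (Cn n)
  dom_open : ∀ p, IsOpen (dom p)
  dom_sub : ∀ p, dom p ⊆ (chartAt (Cn n) p).target
  dom_mem : ∀ p, chartAt (Cn n) p p ∈ dom p
  hol : ∀ p, HolFormOn (dom p) (ω p)
  decomp : ∀ p, LocallyDecomp (dom p) (ω p)
  codim : ∀ p, CodimGE n (zeroLocus (ω p) ∩ dom p) 2
  compat : ∀ p q : M, ∀ x : M, x ∈ (chartAt (Cn n) p).source → x ∈ (chartAt (Cn n) q).source →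
    chartAt (Cn n) p x ∈ dom p → chartAt (Cn n) q x ∈ dom q →
    ∃ W ∈ 𝓝 (chartAt (Cn n) p x), W ⊆ dom p ∧
      ∃ h : Cn n → ℂ, AnalyticOnNhd ℂ h W ∧ (∀ z ∈ W, h z ≠ 0) ∧
      ∀ z ∈ W, ∀ v : Fin (n - k) → Cn n,
        ω p z v = h z * ω q ((chartAt (Cn n) q) ((chartAt (Cn n) p).symm z))
          (fun i => fderiv ℂ (fun y => (chartAt (Cn n) q) ((chartAt (Cn n) p).symm y)) z (v i))

/-- The singular set of a distribution on a manifold. -/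
def MDist.sing (D : MDist n k M) : Set M :=
  {x | D.ω x (chartAt (Cn n) x x) = 0}

/-- A one-dimensional singular holomorphic foliation on a complex `n`-manifold `M`:
around each point it is given, in the chart at that point, by a holomorphic vector field
with singular set of codimension at least 2; on overlaps the local vector fields agree,
up to a nonvanishing holomorphic factor, under the differentials of the transition maps. -/
structure MFol1 (n : ℕ) (M : Type*) [TopologicalSpace M] [ChartedSpace (Cn n) M] where
  V : M → VF n
  dom : M → Set (Cn n)
  dom_open : ∀ p, IsOpen (dom p)
  dom_sub : ∀ p, dom p ⊆ (chartAt (Cn n) p).target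
  dom_mem : ∀ p, chartAt (Cn n) p p ∈ dom p
  hol : ∀ p, AnalyticOnNhd ℂ (V p) (dom p)
  codim : ∀ p, CodimGE n ({z ∈ dom p | V p z = 0}) 2
  compat : ∀ p q : M, ∀ x : M, x ∈ (chartAt (Cn n) p).source → x ∈ (chartAt (Cn n) q).source →
    chartAt (Cn n) p x ∈ dom p → chartAt (Cn n) q x ∈ dom q →
    ∃ W ∈ 𝓝 (chartAt (Cn n) p x), W ⊆ dom p ∧
      ∃ h : Cn n → ℂ, AnalyticOnNhd ℂ h W ∧ (∀ z ∈ W, h z ≠ 0) ∧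
      ∀ z ∈ W,
        fderiv ℂ (fun y => (chartAt (Cn n) q) ((chartAt (Cn n) p).symm y)) z (V p z)
          = h z • V q ((chartAt (Cn n) q) ((chartAt (Cn n) p).symm z))

/-- The singular set of a one-dimensional foliation on a manifold. -/
def MFol1.sing (G : MFol1 n M) : Set M :=
  {x | G.V x (chartAt (Cn n) x x) = 0}

/-- The foliation `G` is tangent to the distribution `D`. -/
def MTangent (G : MFol1 n M) (D : MDist n k M) : Prop :=
  ∀ p : M, ∀ z ∈ G.dom p ∩ D.dom p, TangentAt (D.ω p) (G.V p) z

/-- `G` locally divides `D` at `p` : in the chart at `p`, the germ of the defining vector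
field of `G` divides the germ of the defining form of `D`. -/
def MLocDividesAt (G : MFol1 n M) (D : MDist n k M) (p : M) : Prop :=
  DividesAt (G.V p) (D.ω p) (chartAt (Cn n) p p)

/-- The linear rank of `G` is at least `r`: at every singular point `p`, the rank of the
derivative at (the chart image of) `p` of the defining vector field is at least `r`. -/
def MLinRankGE (G : MFol1 n M) (r : ℕ) : Prop :=
  ∀ p ∈ MFol1.sing G, r ≤ rkAt (G.V p) (chartAt (Cn n) p p)

/-- The stalk of the tangent sheaf of `D` at `p` is a free module with `r` generators. -/
def MStalkFreeWith (D : MDist n k M) (p : M) (r : ℕ) : Prop :=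
  ∃ Xs : Fin r → VF n, (∀ i, AnalyticAt ℂ (Xs i) (chartAt (Cn n) p p)) ∧
    (∀ i, ∀ᶠ z in 𝓝 (chartAt (Cn n) p p), TangentAt (D.ω p) (Xs i) z) ∧
    FreeGensAt (D.ω p) Xs (chartAt (Cn n) p p)

/-- (a) The tangent sheaf of `D` is locally free of rank `k`: near every point there are
`k` holomorphic tangent vector fields which freely generate every stalk. -/
def MPropA (D : MDist n k M) : Prop :=
  ∀ p : M, ∃ U : Set (Cn n), IsOpen U ∧ chartAt (Cn n) p p ∈ U ∧ U ⊆ D.dom p ∧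
    ∃ Xs : Fin k → VF n, (∀ i, AnalyticOnNhd ℂ (Xs i) U) ∧
      (∀ i, ∀ z ∈ U, TangentAt (D.ω p) (Xs i) z) ∧
      ∀ z ∈ U, FreeGensAt (D.ω p) Xs z

/-- (b) Near every point, `T_D` is the direct sum of the tangent sheaves of `k`
one-dimensional foliations (defined by vector fields with singular set of codim `≥ 2`). -/
def MPropB (D : MDist n k M) : Prop :=
  ∀ p : M, ∃ U : Set (Cn n), IsOpen U ∧ chartAt (Cn n) p p ∈ U ∧ U ⊆ D.dom p ∧
    ∃ Xs : Fin k → VF n, (∀ i, AnalyticOnNhd ℂ (Xs i) U) ∧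
      (∀ i, CodimGE n {z ∈ U | Xs i z = 0} 2) ∧
      (∀ i, ∀ z ∈ U, TangentAt (D.ω p) (Xs i) z) ∧
      ∀ z ∈ U, FreeGensAt (D.ω p) Xs z

/-- (c) Near every point, a form `i_{X_1} ⋯ i_{X_k} Θ` defines `D`. -/
def MPropC (h : n = k + (n - k)) (D : MDist n k M) : Prop :=
  ∀ p : M, ∃ U : Set (Cn n), IsOpen U ∧ chartAt (Cn n) p p ∈ U ∧ U ⊆ D.dom p ∧
    ∃ (Xs : Fin k → VF n) (Θ : Form n n) (u : Cn n → ℂ),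
      (∀ i, AnalyticOnNhd ℂ (Xs i) U) ∧ HolFormOn U Θ ∧
      AnalyticOnNhd ℂ u U ∧ (∀ z ∈ U, u z ≠ 0) ∧
      ∀ z ∈ U, ∀ v : Fin (n - k) → Cn n,
        D.ω p z v = u z * Θ z (fun i => Fin.append (fun a => Xs a z) v (Fin.cast h i))

/-- (d) At every point, a form `i_{X_1} ⋯ i_{X_k} Θ` defines the germ of `D`. -/
def MPropD (h : n = k + (n - k)) (D : MDist n k M) : Prop :=
  ∀ p : M, ∃ (Xs : Fin k → VF n) (Θ : Form n n) (u : Cn n → ℂ),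
    (∀ i, AnalyticAt ℂ (Xs i) (chartAt (Cn n) p p)) ∧ HolFormAt (chartAt (Cn n) p p) Θ ∧
    AnalyticAt ℂ u (chartAt (Cn n) p p) ∧ u (chartAt (Cn n) p p) ≠ 0 ∧
    ∀ᶠ z in 𝓝 (chartAt (Cn n) p p), ∀ v : Fin (n - k) → Cn n,
      D.ω p z v = u z * Θ z (fun i => Fin.append (fun a => Xs a z) v (Fin.cast h i))

/-- (e) Every stalk of `T_D` is a free module with `k` generators. -/
def MPropE (D : MDist n k M) : Prop :=
  ∀ p : M, MStalkFreeWith D p k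

/-- A subset `S` of the complex manifold `M` is analytic: it is closed and locally,
in charts, the common zero set of finitely many holomorphic functions. -/
def MIsAnalytic (n : ℕ) {M : Type*} [TopologicalSpace M] [ChartedSpace (Cn n) M] (S : Set M) : Prop :=
  IsClosed S ∧ ∀ p : M, ∃ W ∈ 𝓝 (chartAt (Cn n) p p), ∃ (r : ℕ) (f : Fin r → Cn n → ℂ),
    (∀ i, AnalyticOnNhd ℂ (f i) W) ∧
    ∀ z ∈ W ∩ (chartAt (Cn n) p).target, ((chartAt (Cn n) p).symm z ∈ S ↔ ∀ i, f i z = 0)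

/-- Irreducible analytic subsets of `M`. -/
def MIrredAnalytic (n : ℕ) {M : Type*} [TopologicalSpace M] [ChartedSpace (Cn n) M] (S : Set M) : Prop :=
  MIsAnalytic n S ∧ S.Nonempty ∧
    ∀ S1 S2 : Set M, MIsAnalytic n S1 → MIsAnalytic n S2 → S = S1 ∪ S2 → S = S1 ∨ S = S2

/-- `C` is an irreducible component of `V ⊆ M`. -/
def MIrredComponentOf (n : ℕ) {M : Type*} [TopologicalSpace M] [ChartedSpace (Cn n) M] (V C : Set M) : Prop :=
  MIrredAnalytic n C ∧ C ⊆ V ∧ ∀ C', MIrredAnalytic n C' → C ⊆ C' → C' ⊆ V → C' = C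

/-- The local dimension of `S ⊆ M` at `p` equals `d` (via Hausdorff dimension of chart
images on small neighborhoods). -/
def MLocDimEq (n : ℕ) {M : Type*} [TopologicalSpace M] [ChartedSpace (Cn n) M] (S : Set M) (p : M) (d : ℕ) : Prop :=
  ∀ᶠ U in (𝓝 p).smallSets,
    dimH (chartAt (Cn n) p '' (S ∩ U ∩ (chartAt (Cn n) p).source)) = ((2 * d : ℕ) : ℝ≥0∞)

/-- The dimension of `S ⊆ M` equals `d`. -/
def MDimEq (n : ℕ) {M : Type*} [TopologicalSpace M] [ChartedSpace (Cn n) M] (S : Set M) (d : ℕ) : Prop :=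
  (∀ p : M, ∀ᶠ U in (𝓝 p).smallSets,
    dimH (chartAt (Cn n) p '' (S ∩ U ∩ (chartAt (Cn n) p).source)) ≤ ((2 * d : ℕ) : ℝ≥0∞)) ∧
  ∃ p : M, MLocDimEq n S p d

end Manifold

end

section Aux
open scoped ENNReal NNReal

noncomputable def liftMul {E K : Type*} [NormedAddCommGroup E] [NormedSpace ℂ E]
    [TopologicalSpace K] [CompactSpace K] (k : ℕ)
    (a : ContinuousMultilinearMap ℂ (fun _ : Fin k => E) ℂ) :
    ContinuousMultilinearMap ℂ (fun _ : Fin k => C(K, E)) C(K, ℂ) :=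
  MultilinearMap.mkContinuous
    { toFun := fun g => ⟨fun x => a (fun i => g i x), by fun_prop⟩
      map_update_add' := by
        intro _ g i x y
        ext t
        have h : ∀ w : C(K, E), (fun j => (Function.update g i w) j t)
            = Function.update (fun j => g j t) i (w t) := by
          intro w; funext j
          by_cases hj : j = i
          · subst hj; simp
          · simp [hj]
        simp only [ContinuousMap.coe_mk, ContinuousMap.add_apply]
        rw [h, h, h, ContinuousMap.add_apply]
        exact a.toMultilinearMap.map_update_add' _ _ _ _
      map_update_smul' := by
        intro _ g i c x
        ext t
        have h : ∀ w : C(K, E), (fun j => (Function.update g i w) j t)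
            = Function.update (fun j => g j t) i (w t) := by
          intro w; funext j
          by_cases hj : j = i
          · subst hj; simp
          · simp [hj]
        simp only [ContinuousMap.coe_mk, ContinuousMap.smul_apply]
        rw [h, h, ContinuousMap.smul_apply]
        exact a.toMultilinearMap.map_update_smul' _ _ _ _ }
    ‖a‖ (by
      intro g
      refine (ContinuousMap.norm_le _ (by positivity)).2 fun t => ?_
      refine (a.le_opNorm _).trans ?_
      gcongr with i
      exact (g i).norm_coe_le_norm t)

theorem liftMul_apply {E K : Type*} [NormedAddCommGroup E] [NormedSpace ℂ E]
    [TopologicalSpace K] [CompactSpace K] (k : ℕ)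
    (a : ContinuousMultilinearMap ℂ (fun _ : Fin k => E) ℂ) (g : Fin k → C(K, E)) (t : K) :
    liftMul k a g t = a (fun i => g i t) := rfl

theorem liftMul_norm {E K : Type*} [NormedAddCommGroup E] [NormedSpace ℂ E]
    [TopologicalSpace K] [CompactSpace K] (k : ℕ)
    (a : ContinuousMultilinearMap ℂ (fun _ : Fin k => E) ℂ) :
    ‖liftMul (K := K) k a‖ ≤ ‖a‖ :=
  MultilinearMap.mkContinuous_norm_le _ (norm_nonneg _) _

/-- superposition operators on `C(K, E)` are analytic. -/
theorem superposition {E : Type*} [NormedAddCommGroup E] [NormedSpace ℂ E]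
    {p : E → ℂ} (hp : AnalyticAt ℂ p 0) :
    ∃ R > 0, ∀ (K : Type) [TopologicalSpace K] [CompactSpace K],
      ∃ P : C(K, E) → C(K, ℂ), ∀ g : C(K, E), ‖g‖ < R →
      AnalyticAt ℂ P g ∧ ∀ t, P g t = p (g t) := by
  obtain ⟨s, r, hs⟩ := hp
  obtain ⟨R, hR0, hRr⟩ := ENNReal.lt_iff_exists_nnreal_btwn.1 hs.r_pos
  refine ⟨R, by simpa using hR0, ?_⟩
  intro K _ _
  set S : FormalMultilinearSeries ℂ C(K, E) C(K, ℂ) := fun k => liftMul k (s k) with hS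
  have hrad : r ≤ S.radius := by
    refine ENNReal.le_of_forall_nnreal_lt fun ρ hρ => ?_
    obtain ⟨C, -, hC⟩ := s.norm_mul_pow_le_of_lt_radius (hρ.trans_le hs.r_le)
    refine S.le_radius_of_bound C fun k => le_trans ?_ (hC k)
    gcongr
    exact liftMul_norm _ _
  have hpos : 0 < S.radius := hs.r_pos.trans_le hrad
  have hball := S.hasFPowerSeriesOnBall hpos
  refine ⟨S.sum, fun g hg => ?_⟩
  have hg' : g ∈ Metric.eball (0 : C(K, E)) S.radius := by
    rw [Metric.mem_eball, edist_zero_right]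
    refine lt_of_lt_of_le (lt_trans ?_ hRr) hrad
    rw [enorm_eq_nnnorm]
    exact_mod_cast hg
  refine ⟨hball.analyticAt_of_mem hg', fun t => ?_⟩
  have h1 := hball.hasSum hg'
  rw [zero_add] at h1
  have h2 := h1.map (ContinuousMap.evalCLM ℂ t) (ContinuousMap.evalCLM ℂ t).continuous
  have hgt : g t ∈ Metric.eball (0 : E) r := by
    rw [Metric.mem_eball, edist_zero_right]
    refine lt_trans ?_ hRr
    rw [enorm_eq_nnnorm]
    exact_mod_cast (g.norm_coe_le_norm t).trans_lt hg
  have h3 := hs.hasSum hgt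
  rw [zero_add] at h3
  exact h2.unique h3

/-- averaging over the circle, as a continuous functional on `C(sphere 0 r, ℂ)`. -/
theorem exists_avg {r : ℝ} (hr : 0 < r) : ∃ L : C(Metric.sphere (0 : ℂ) r, ℂ) →L[ℂ] ℂ,
    ∀ (a : C(Metric.sphere (0 : ℂ) r, ℂ)) (f : ℂ → ℂ), (∀ t, a t = f t) →
      L a = Real.circleAverage f 0 r := by
  have hmem : ∀ θ : ℝ, circleMap 0 r θ ∈ Metric.sphere (0 : ℂ) r :=
    fun θ => circleMap_mem_sphere _ hr.le _
  have hcont : ∀ a : C(Metric.sphere (0 : ℂ) r, ℂ), Continuous fun θ : ℝ => a ⟨_, hmem θ⟩ := by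
    intro a
    exact a.continuous.comp ((continuous_circleMap 0 r).subtype_mk hmem)
  refine ⟨LinearMap.mkContinuous
    { toFun := fun a => (2 * Real.pi)⁻¹ • ∫ θ in (0 : ℝ)..2 * Real.pi, a ⟨_, hmem θ⟩
      map_add' := by
        intro a b
        simp only [ContinuousMap.add_apply]
        rw [intervalIntegral.integral_add ((hcont a).intervalIntegrable _ _)
          ((hcont b).intervalIntegrable _ _), smul_add]
      map_smul' := by
        intro c a
        simp only [ContinuousMap.smul_apply, intervalIntegral.integral_smul, RingHom.id_apply]
        rw [smul_comm] } 1 ?_, ?_⟩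
  · intro a
    simp only [LinearMap.coe_mk, AddHom.coe_mk, norm_smul, one_mul]
    have := intervalIntegral.norm_integral_le_of_norm_le_const (a := 0) (b := 2 * Real.pi)
      (f := fun θ => a ⟨_, hmem θ⟩) (C := ‖a‖) (fun θ _ => a.norm_coe_le_norm _)
    have hpi := Real.pi_pos
    rw [sub_zero, abs_of_pos (by positivity)] at this
    rw [Real.norm_of_nonneg (by positivity), inv_mul_le_iff₀ (by positivity)]
    linarith
  · intro a f haf
    simp only [LinearMap.mkContinuous_apply, LinearMap.coe_mk, AddHom.coe_mk, haf]
    rfl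

/-- Hartogs-type extension. -/
theorem hartogs_ext {E : Type*} [NormedAddCommGroup E] [NormedSpace ℂ E] (S B : Set E)
    (hB : B ∈ 𝓝 (0 : E)) (p q f : E → ℂ) (e : E) (hp : AnalyticAt ℂ p 0) (hq : AnalyticAt ℂ q 0)
    (hqe : ¬ ∀ᶠ t : ℂ in 𝓝 0, q (t • e) = 0)
    (hf : ∀ z ∈ B, z ∉ S → AnalyticAt ℂ f z ∧ p z = f z * q z) :
    ∃ F : E → ℂ, AnalyticAt ℂ F 0 ∧
      ∀ᶠ z in 𝓝 (0 : E), (∀ t : ℂ, z + t • e ∉ S) → F z = f z := by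
  have hlin : AnalyticAt ℂ (fun t : ℂ => q (t • e)) 0 := by
    have : AnalyticAt ℂ (fun t : ℂ => t • e) 0 := by fun_prop
    exact AnalyticAt.comp (g := q) (by simpa using hq) this
  have hne := hlin.eventually_eq_zero_or_eventually_ne_zero.resolve_left hqe
  obtain ⟨R0, hR0, hBR⟩ := Metric.mem_nhds_iff.1 hB
  obtain ⟨r0, hr0, hne'⟩ := Metric.mem_nhdsWithin_iff.1 hne
  obtain ⟨Rp, hRp, hP⟩ := superposition hp
  obtain ⟨Rq, hRq, hQ⟩ := superposition hq
  set M : ℝ := min R0 (min Rp Rq) with hM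
  have hM0 : 0 < M := lt_min hR0 (lt_min hRp hRq)
  set r : ℝ := min (r0 / 2) (M / (2 * (‖e‖ + 1))) with hr
  have hr_pos : 0 < r := lt_min (by positivity) (by positivity)
  have hre : r * ‖e‖ ≤ M / 2 := by
    have h1 : r ≤ M / (2 * (‖e‖ + 1)) := min_le_right _ _
    have h2 : r * (‖e‖ + 1) ≤ M / 2 := by
      calc r * (‖e‖ + 1) ≤ M / (2 * (‖e‖ + 1)) * (‖e‖ + 1) := by gcongr
        _ = M / 2 := by field_simp
    nlinarith
  have hrr0 : r < r0 := lt_of_le_of_lt (min_le_left _ _) (by linarith)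
  have hnorm : ∀ z : E, ‖z‖ < M / 2 → ∀ t : ℂ, ‖t‖ ≤ r → ‖z + t • e‖ < M := by
    intro z hz t ht
    calc ‖z + t • e‖ ≤ ‖z‖ + ‖t‖ * ‖e‖ := (norm_add_le _ _).trans (by rw [norm_smul])
      _ ≤ ‖z‖ + r * ‖e‖ := by gcongr
      _ < M := by linarith
  obtain ⟨P, hP⟩ := hP (Metric.sphere (0 : ℂ) r)
  obtain ⟨Q, hQ⟩ := hQ (Metric.sphere (0 : ℂ) r)
  obtain ⟨L, hL⟩ := exists_avg hr_pos
  let g0 : C(Metric.sphere (0 : ℂ) r, E) := ⟨fun t => (t : ℂ) • e, by fun_prop⟩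
  let Φ : E → C(Metric.sphere (0 : ℂ) r, E) := fun z => ContinuousLinearMap.const ℂ _ z + g0
  have hΦ : ∀ z t, Φ z t = z + (t : ℂ) • e := fun z t => rfl
  have hΦa : AnalyticAt ℂ Φ 0 := by
    have : AnalyticAt ℂ (fun z : E =>
        ContinuousLinearMap.const ℂ (Metric.sphere (0 : ℂ) r) z) 0 :=
      (ContinuousLinearMap.const ℂ (Metric.sphere (0 : ℂ) r) :
        E →L[ℂ] C(Metric.sphere (0 : ℂ) r, E)).analyticAt 0
    exact this.add analyticAt_const
  have hΦn : ∀ z : E, ‖z‖ < M / 2 → ‖Φ z‖ < M := by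
    intro z hz
    rw [ContinuousMap.norm_lt_iff _ hM0]
    intro t
    rw [hΦ]
    exact hnorm z hz t (mem_sphere_zero_iff_norm.1 t.2).le
  have hMp : M ≤ Rp := (min_le_right _ _).trans (min_le_left _ _)
  have hMq : M ≤ Rq := (min_le_right _ _).trans (min_le_right _ _)
  have h00 : ‖(0 : E)‖ < M / 2 := by simpa using hM0
  have hPa : AnalyticAt ℂ (fun z => P (Φ z)) 0 :=
    (hP _ ((hΦn 0 h00).trans_le hMp)).1.comp hΦa
  have hQa : AnalyticAt ℂ (fun z => Q (Φ z)) 0 :=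
    (hQ _ ((hΦn 0 h00).trans_le hMq)).1.comp hΦa
  have hunit : IsUnit (Q (Φ 0)) := by
    rw [ContinuousMap.isUnit_iff_forall_ne_zero]
    intro t
    rw [(hQ _ ((hΦn 0 h00).trans_le hMq)).2 t, hΦ, zero_add]
    have ht : ‖(t : ℂ)‖ = r := mem_sphere_zero_iff_norm.1 t.2
    refine hne' ⟨?_, ?_⟩
    · simpa [ht] using hrr0
    · intro h
      simp only [mem_singleton_iff] at h
      rw [h, norm_zero] at ht
      exact hr_pos.ne ht
  have hinv : AnalyticAt ℂ (fun z => Ring.inverse (Q (Φ z))) 0 := by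
    have := analyticAt_inverse (𝕜 := ℂ) hunit.unit
    exact AnalyticAt.comp (g := Ring.inverse) (by simpa using this) hQa
  refine ⟨fun z => L (P (Φ z) * Ring.inverse (Q (Φ z))), ?_, ?_⟩
  · exact (L.analyticAt _).comp (hPa.mul hinv)
  have hunits : ∀ᶠ z in 𝓝 (0 : E), IsUnit (Q (Φ z)) :=
    hQa.continuousAt.eventually (Units.isOpen.mem_nhds hunit)
  have hsmall : ∀ᶠ z in 𝓝 (0 : E), ‖z‖ < M / 2 := by
    filter_upwards [Metric.ball_mem_nhds (0 : E) (half_pos hM0)] with z hz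
    simpa using hz
  filter_upwards [hunits, hsmall] with z hzu hz hgood
  have hzB : ∀ t : ℂ, ‖t‖ ≤ r → z + t • e ∈ B := fun t ht => hBR (by
    rw [mem_ball_zero_iff]
    exact (hnorm z hz t ht).trans_le (min_le_left _ _))
  rw [hL _ (fun t => f (z + t • e))]
  · have hd : ∀ t : ℂ, ‖t‖ ≤ r → DifferentiableAt ℂ (fun t : ℂ => f (z + t • e)) t := by
      intro t ht
      have h1 := (hf _ (hzB t ht) (hgood t)).1.differentiableAt
      exact DifferentiableAt.comp (g := f) t h1 (by fun_prop)
    have : DiffContOnCl ℂ (fun t : ℂ => f (z + t • e)) (Metric.ball 0 |r|) := by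
      rw [abs_of_pos hr_pos]
      refine DifferentiableOn.diffContOnCl fun t ht => ?_
      rw [closure_ball _ hr_pos.ne'] at ht
      exact (hd t (by simpa using ht)).differentiableWithinAt
    rw [this.circleAverage]
    simp
  · intro t
    have ht : ‖(t : ℂ)‖ = r := mem_sphere_zero_iff_norm.1 t.2
    have h1 := (hf _ (hzB t ht.le) (hgood t)).2
    have hq0 : q (z + (t : ℂ) • e) ≠ 0 := by
      have := (ContinuousMap.isUnit_iff_forall_ne_zero _).1 hzu t
      rwa [(hQ _ ((hΦn z hz).trans_le hMq)).2 t, hΦ] at this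
    have h2 : Q (Φ z) t * Ring.inverse (Q (Φ z)) t = 1 := by
      rw [← ContinuousMap.mul_apply, Ring.mul_inverse_cancel _ hzu]; rfl
    rw [(hQ _ ((hΦn z hz).trans_le hMq)).2 t, hΦ] at h2
    rw [ContinuousMap.mul_apply, (hP _ ((hΦn z hz).trans_le hMp)).2 t, hΦ, h1, mul_assoc, h2,
      mul_one]

/-- Lines avoiding a set of small Hausdorff dimension are dense. -/
theorem dense_good {n : ℕ} (S : Set (Fin n → ℂ)) (hS : S = ∅ ∨ dimH S + 2 * ((2 : ℕ) : ℝ≥0∞) ≤ 2 * (n : ℝ≥0∞))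
    (e : Fin n → ℂ) (he : e ≠ 0) : Dense {z : Fin n → ℂ | ∀ t : ℂ, z + t • e ∉ S} := by
  rcases hS with rfl | hS
  · simp
  obtain ⟨i, hi⟩ := Function.ne_iff.1 he
  let φ : (Fin n → ℂ) →L[ℂ] ℂ := (e i)⁻¹ • ContinuousLinearMap.proj i
  have hφ : φ e = 1 := by
    simp [φ, inv_mul_cancel₀ hi]
  let π : (Fin n → ℂ) →L[ℂ] φ.ker :=
    (ContinuousLinearMap.id ℂ _ - φ.smulRight e).codRestrict _ (by intro x; simp [hφ])
  have hπe : π e = 0 := by ext; simp [π, hφ]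
  have hsurj : Function.Surjective π := by
    rintro ⟨x, hx⟩
    refine ⟨x, ?_⟩
    have : φ x = 0 := hx
    ext j; simp [π, this]
  have hrank : Module.finrank ℂ φ.ker + 1 = n := by
    have h := LinearMap.finrank_range_add_finrank_ker φ.toLinearMap
    have h2 : LinearMap.range φ.toLinearMap = ⊤ := by
      rw [LinearMap.range_eq_top]
      intro c; exact ⟨c • e, by simp [hφ]⟩
    rw [h2] at h
    simp at h
    have h3 : Module.finrank ℂ φ.ker = Module.finrank ℂ (LinearMap.ker φ.toLinearMap) := rfl
    omega
  have hdim : dimH (π '' S) < Module.finrank ℝ φ.ker := by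
    refine (π.lipschitz.dimH_image_le S).trans_lt ?_
    rw [finrank_real_of_complex]
    have : (n : ℝ≥0∞) = (Module.finrank ℂ φ.ker : ℝ≥0∞) + 1 := by exact_mod_cast hrank.symm
    rw [this] at hS
    generalize dimH S = d at *
    have hd : d ≠ ⊤ := by
      rintro rfl
      simp at hS
      exact absurd hS (by simp [ENNReal.mul_eq_top])
    lift d to ℝ≥0 using hd
    norm_cast at hS ⊢
    rw [← NNReal.coe_lt_coe]
    rw [← NNReal.coe_le_coe] at hS
    push_cast at *
    linarith
  have hD := dense_compl_of_dimH_lt_finrank hdim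
  have hopen : IsOpenMap π := π.isOpenMap hsurj
  refine (hD.preimage hopen).mono ?_
  intro z hz t ht
  refine hz ⟨_, ht, ?_⟩
  simp [hπe]

theorem top_form_eq_det {N : ℕ} (Θ : AlternatingMap ℂ (Cn N) ℂ (Fin N)) (w : Fin N → Cn N) :
    Θ w = Θ (Pi.basisFun ℂ (Fin N)) * Matrix.det (Matrix.of w) := by
  conv_lhs => rw [Θ.eq_smul_basis_det (Pi.basisFun ℂ (Fin N))]
  rw [AlternatingMap.smul_apply, Pi.basisFun_det]
  rfl

theorem top_form_cramer {N : ℕ} (Θ : AlternatingMap ℂ (Cn N) ℂ (Fin N)) (w : Fin N → Cn N)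
    (x : Cn N) : Θ w • x = ∑ i, Θ (Function.update w i x) • w i := by
  have h := Matrix.mulVec_cramer (Matrix.of w).transpose x
  rw [Matrix.det_transpose] at h
  have h2 : ∀ i, Matrix.cramer (Matrix.of w).transpose x i
      = Matrix.det (Matrix.of (Function.update w i x)) := by
    intro i
    rw [Matrix.cramer_transpose_apply]
    rfl
  rw [top_form_eq_det Θ w, mul_smul, ← h]
  have h3 : ∀ i, Θ (Function.update w i x) = Θ (Pi.basisFun ℂ (Fin N)) *
      Matrix.det (Matrix.of (Function.update w i x)) := fun i => top_form_eq_det Θ _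
  rw [Finset.sum_congr rfl (fun i _ => by rw [h3 i, ← h2 i, mul_smul] :
    ∀ i ∈ Finset.univ, Θ (Function.update w i x) • w i = Θ (Pi.basisFun ℂ (Fin N)) •
      (Matrix.cramer (Matrix.of w).transpose x i • w i)), ← Finset.smul_sum]
  congr 1
  ext j
  rw [Finset.sum_apply]
  change ∑ i, (Matrix.of w).transpose j i * Matrix.cramer (Matrix.of w).transpose x i = _
  refine Finset.sum_congr rfl fun i _ => ?_
  exact mul_comm _ _

theorem top_form_pair {m : ℕ} (Θ : AlternatingMap ℂ (Cn (m + 2)) ℂ (Fin (m + 2)))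
    (X Y Z : Cn (m + 2)) (v : Fin m → Cn (m + 2))
    (h : ∀ i, Θ (Fin.cons Y (Fin.cons Z (Function.update v i X))) = 0) :
    Θ (Fin.cons Y (Fin.cons Z v)) • X =
      Θ (Fin.cons X (Fin.cons Z v)) • Y + Θ (Fin.cons Y (Fin.cons X v)) • Z := by
  rw [top_form_cramer, Fin.sum_univ_succ, Fin.sum_univ_succ]
  have h1 : ∀ i : Fin m, Function.update (Fin.cons Y (Fin.cons Z v) : Fin (m + 2) → Cn (m + 2))
      i.succ.succ X = Fin.cons Y (Fin.cons Z (Function.update v i X)) := by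
    intro i
    rw [← Fin.cons_update, ← Fin.cons_update]
  have h2 : Function.update (Fin.cons Y (Fin.cons Z v) : Fin (m + 2) → Cn (m + 2))
      (Fin.succ 0) X = Fin.cons Y (Fin.cons X v) := by
    rw [← Fin.cons_update, Fin.update_cons_zero]
  rw [h2, Fin.update_cons_zero]
  have h4 : ∑ i : Fin m, Θ (Function.update
      (Fin.cons Y (Fin.cons Z v) : Fin (m + 2) → Cn (m + 2)) i.succ.succ X) •
      (Fin.cons Y (Fin.cons Z v) : Fin (m + 2) → Cn (m + 2)) i.succ.succ = 0 :=
    Finset.sum_eq_zero fun i _ => by rw [h1 i, h i, zero_smul]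
  rw [h4, add_zero]
  rfl

theorem analytic_top_form {N : ℕ} {Θ : Form N N} {c : Cn N} (hΘ : HolFormAt c Θ)
    (w : Fin N → VF N) (hw : ∀ i, AnalyticAt ℂ (w i) c) :
    AnalyticAt ℂ (fun z => Θ z (fun i => w i z)) c := by
  have h : (fun z => Θ z (fun i => w i z)) = fun z => Θ z (Pi.basisFun ℂ (Fin N)) *
      ∑ σ : Equiv.Perm (Fin N), ((Equiv.Perm.sign σ : ℤ) : ℂ) * ∏ i, w (σ i) z i := by
    funext z
    rw [top_form_eq_det, Matrix.det_apply']
    rfl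
  rw [h]
  refine (hΘ _).mul ?_
  refine Finset.analyticAt_fun_sum _ fun σ _ => ?_
  refine analyticAt_const.mul ?_
  refine Finset.analyticAt_fun_prod _ fun i _ => ?_
  exact (analyticAt_pi_iff.1 (hw (σ i))) i

theorem analytic_pair {m : ℕ} {Θ : Form (m + 2) (m + 2)} {c : Cn (m + 2)} (hΘ : HolFormAt c Θ)
    {Y Z : VF (m + 2)} (hY : AnalyticAt ℂ Y c) (hZ : AnalyticAt ℂ Z c)
    (v : Fin m → Cn (m + 2)) :
    AnalyticAt ℂ (fun z => Θ z (Fin.cons (Y z) (Fin.cons (Z z) v))) c := by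
  have := analytic_top_form hΘ (Fin.cons Y (Fin.cons Z fun i _ => v i)) (by
    intro i
    refine Fin.cases hY (fun i => ?_) i
    refine Fin.cases hZ (fun i => ?_) i
    exact analyticAt_const)
  convert this using 3 with z
  funext i
  refine Fin.cases rfl (fun i => ?_) i
  refine Fin.cases rfl (fun i => ?_) i
  rfl

theorem exists_top_ne_zero {m : ℕ} (Θ : AlternatingMap ℂ (Cn (m + 2)) ℂ (Fin (m + 2)))
    (hΘ : Θ (Pi.basisFun ℂ (Fin (m + 2))) ≠ 0) (Y Z : Cn (m + 2))
    (hli : LinearIndependent ℂ ![Y, Z]) :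
    ∃ v : Fin m → Cn (m + 2), Θ (Fin.cons Y (Fin.cons Z v)) ≠ 0 := by
  let b := Module.Basis.sumExtend hli
  have : Fintype (Fin 2 ⊕ Module.Basis.sumExtendIndex hli) := FiniteDimensional.fintypeBasisIndex b
  have : Finite (Module.Basis.sumExtendIndex hli) := Finite.sum_right (α := Fin 2)
  have := Fintype.ofFinite (Module.Basis.sumExtendIndex hli)
  have hcard : Fintype.card (Module.Basis.sumExtendIndex hli) = m := by
    have h := Module.finrank_eq_nat_card_basis b
    rw [Nat.card_sum] at h
    rw [Module.finrank_fin_fun, Nat.card_eq_fintype_card, Nat.card_eq_fintype_card,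
      Fintype.card_fin] at h
    omega
  let ε := Fintype.equivFinOfCardEq hcard
  refine ⟨fun j => b (Sum.inr (ε.symm j)), ?_⟩
  have hspan : ⊤ ≤ Submodule.span ℂ (Set.range
      (Fin.cons Y (Fin.cons Z fun j => b (Sum.inr (ε.symm j))) : Fin (m + 2) → Cn (m + 2))) := by
    rw [← b.span_eq]
    refine Submodule.span_mono ?_
    rintro _ ⟨x, rfl⟩
    rcases x with x | x
    · have : b (Sum.inl x) = ![Y, Z] x := by
        simp only [b, Module.Basis.sumExtend, Module.Basis.reindex_apply]
        exact Module.Basis.extend_apply_self _ _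
      rw [this]
      fin_cases x
      · exact ⟨0, rfl⟩
      · exact ⟨1, rfl⟩
    · exact ⟨(ε x).succ.succ, by simp⟩
  have hli2 := linearIndependent_of_top_le_span_of_card_eq_finrank hspan (by simp)
  rw [top_form_eq_det]
  refine mul_ne_zero hΘ ?_
  have := Matrix.linearIndependent_rows_iff_isUnit (A := Matrix.of
    (Fin.cons Y (Fin.cons Z fun j => b (Sum.inr (ε.symm j))) : Fin (m + 2) → Cn (m + 2)))|>.1 hli2
  exact ((Matrix.isUnit_iff_isUnit_det _).1 this).ne_zero

theorem line_not_zero {E : Type*} [NormedAddCommGroup E] [NormedSpace ℂ E] {R : ℝ} (φ : E → ℂ)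
    (hφ : ∀ z ∈ Metric.ball (0 : E) R, AnalyticAt ℂ φ z) (z0 : E) (hz0 : z0 ∈ Metric.ball (0 : E) R)
    (hne : φ z0 ≠ 0) : ¬ ∀ᶠ t : ℂ in 𝓝 0, φ (t • z0) = 0 := by
  intro h
  have hR : 0 < R := Metric.pos_of_mem_ball hz0
  let T : Set ℂ := {t | t • z0 ∈ Metric.ball (0 : E) R}
  have hconv : Convex ℝ T := by
    intro s hs t ht a b ha hb hab
    have : (a • s + b • t) • z0 = a • (s • z0) + b • (t • z0) := by
      rw [add_smul, smul_assoc, smul_assoc]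
    change (a • s + b • t) • z0 ∈ Metric.ball (0 : E) R
    rw [this]
    exact convex_ball (0 : E) R hs ht ha hb hab
  have han : AnalyticOnNhd ℂ (fun t : ℂ => φ (t • z0)) T := by
    intro t ht
    have : AnalyticAt ℂ (fun t : ℂ => t • z0) t := by fun_prop
    exact AnalyticAt.comp (g := φ) (hφ _ ht) this
  have h0 : (0 : ℂ) ∈ T := by simpa [T] using hR
  have h1 : (1 : ℂ) ∈ T := by
    change (1 : ℂ) • z0 ∈ Metric.ball (0 : E) R
    rwa [one_smul]
  have := han.eqOn_zero_of_preconnected_of_eventuallyEq_zero hconv.isPreconnected h0 h h1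
  simp at this
  exact hne this

theorem quot_exists {E V : Type*} [NormedAddCommGroup E] [NormedSpace ℂ E] {B : Set E}
    (hB : IsOpen B) (a b : E → V → ℂ) (ha : ∀ z ∈ B, ∀ v, AnalyticAt ℂ (fun w => a w v) z)
    (hb : ∀ z ∈ B, ∀ v, AnalyticAt ℂ (fun w => b w v) z)
    (hab : ∀ z ∈ B, ∀ u v, b z v * a z u = a z v * b z u) :
    ∃ f : E → ℂ, ∀ z ∈ B, (∃ v, b z v ≠ 0) → AnalyticAt ℂ f z ∧ ∀ u, a z u = f z * b z u := by
  classical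
  let f : E → ℂ := fun z => if h : ∃ v, b z v ≠ 0 then a z h.choose / b z h.choose else 0
  have hf : ∀ z ∈ B, ∀ v, b z v ≠ 0 → f z = a z v / b z v := by
    intro z hz v hv
    have h : ∃ v, b z v ≠ 0 := ⟨v, hv⟩
    have hc := h.choose_spec
    simp only [f, dif_pos h]
    rw [div_eq_div_iff hc hv]
    have := hab z hz v h.choose
    linear_combination -this
  refine ⟨f, fun z hz ⟨v, hv⟩ => ⟨?_, fun u => ?_⟩⟩
  · have h1 : AnalyticAt ℂ (fun w => a w v / b w v) z := (ha z hz v).div (hb z hz v) hv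
    refine h1.congr ?_
    filter_upwards [hB.mem_nhds hz, (hb z hz v).continuousAt.eventually_ne hv] with w hw hwv
    exact (hf w hw v hwv).symm
  · rw [hf z hz v hv]
    have := hab z hz u v
    field_simp
    linear_combination this

theorem zero_of_dense {E F : Type*} [NormedAddCommGroup E] [NormedSpace ℂ E]
    [NormedAddCommGroup F] [NormedSpace ℂ F] [CompleteSpace F] {A : E → F} {c : E}
    (hA : AnalyticAt ℂ A c)
    {D : Set E} (hD : Dense D) (h : ∀ᶠ z in 𝓝 c, z ∈ D → A z = 0) : ∀ᶠ z in 𝓝 c, A z = 0 := by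
  filter_upwards [h.eventually_nhds, hA.eventually_analyticAt] with z hz hAz
  by_contra hne
  have h1 := hz.and (hAz.continuousAt.eventually_ne hne)
  obtain ⟨w, hwD, hw⟩ := hD.inter_nhds_nonempty h1
  exact hw.2 (hw.1 hwD)

theorem holForm_top {N : ℕ} {Θ : Form N N} {c : Cn N}
    (h : AnalyticAt ℂ (fun z => Θ z (Pi.basisFun ℂ (Fin N))) c) : HolFormAt c Θ := by
  intro v
  have : (fun z => Θ z v) = fun z => Θ z (Pi.basisFun ℂ (Fin N)) * Matrix.det (Matrix.of v) := by
    funext z; exact top_form_eq_det _ _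
  rw [this]
  exact h.mul analyticAt_const

theorem cons_swap {m : ℕ} (Θ : AlternatingMap ℂ (Cn (m + 2)) ℂ (Fin (m + 2)))
    (x y : Cn (m + 2)) (v : Fin m → Cn (m + 2)) :
    Θ (Fin.cons x (Fin.cons y v)) = - Θ (Fin.cons y (Fin.cons x v)) := by
  rw [← Θ.map_swap _ (show (0 : Fin (m + 2)) ≠ 1 by simp)]
  congr 1
  funext i
  refine Fin.cases ?_ (fun i => ?_) i
  · simp
  refine Fin.cases ?_ (fun i => ?_) i
  · simp
  · have h1 : i.succ.succ ≠ (0 : Fin (m + 2)) := Fin.succ_ne_zero _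
    have h2 : i.succ.succ ≠ (1 : Fin (m + 2)) := by
      intro h
      exact Fin.succ_ne_zero i (Fin.succ_injective _ h)
    simp [Equiv.swap_apply_of_ne_of_ne h1 h2]

theorem cons_lin1 {m : ℕ} (Θ : AlternatingMap ℂ (Cn (m + 2)) ℂ (Fin (m + 2)))
    (a b : ℂ) (x y z : Cn (m + 2)) (v : Fin m → Cn (m + 2)) :
    Θ (Fin.cons (a • x + b • y) (Fin.cons z v)) =
      a * Θ (Fin.cons x (Fin.cons z v)) + b * Θ (Fin.cons y (Fin.cons z v)) := by
  have h : ∀ x, Θ (Fin.cons x (Fin.cons z v)) = Θ.curryLeft x (Fin.cons z v) := fun x => rfl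
  rw [h, h, h, map_add, map_smul, map_smul]
  rfl

theorem cons_same {m : ℕ} (Θ : AlternatingMap ℂ (Cn (m + 2)) ℂ (Fin (m + 2)))
    (x : Cn (m + 2)) (v : Fin m → Cn (m + 2)) :
    Θ (Fin.cons x (Fin.cons x v)) = 0 :=
  Θ.map_eq_zero_of_eq _ (i := 0) (j := 1) rfl (by simp)

theorem cons_lin2 {m : ℕ} (Θ : AlternatingMap ℂ (Cn (m + 2)) ℂ (Fin (m + 2)))
    (a b : ℂ) (x y z : Cn (m + 2)) (v : Fin m → Cn (m + 2)) :
    Θ (Fin.cons z (Fin.cons (a • x + b • y) v)) =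
      a * Θ (Fin.cons z (Fin.cons x v)) + b * Θ (Fin.cons z (Fin.cons y v)) := by
  rw [cons_swap, cons_lin1, cons_swap Θ x z, cons_swap Θ y z]
  ring

theorem statement_aux (m : ℕ) (hm : 1 ≤ m)
    (ω : Form (m + 2) m) (hω0 : ω 0 = 0) (hdist : IsGermDist (m + 2) m ω)
    (hfree : GermLocFree2 (m + 2) m ω)
    (X : VF (m + 2)) (hX : AnalyticAt ℂ X 0)
    (htan : ∀ᶠ z in 𝓝 (0 : Cn (m + 2)), TangentAt ω X z)
    (hrk : 2 ≤ rkAt X 0) :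
    DividesAt X ω 0 := by
  obtain ⟨Y, Z, Θ, hY, hZ, hΘ, heq⟩ := hfree
  obtain ⟨U1, hU1, hol, -⟩ := hdist.hol
  obtain ⟨U2, hU2, hcod⟩ := hdist.codim
  set S : Set (Cn (m + 2)) := zeroLocus ω ∩ U2 with hS
  set h : Cn (m + 2) → ℂ := fun z => Θ z (Pi.basisFun ℂ (Fin (m + 2))) with hh
  have hha : AnalyticAt ℂ h 0 := hΘ _
  have hall : ∀ᶠ z in 𝓝 (0 : Cn (m + 2)), z ∈ U1 ∧ z ∈ U2 ∧ AnalyticAt ℂ h z ∧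
      AnalyticAt ℂ X z ∧ AnalyticAt ℂ Y z ∧ AnalyticAt ℂ Z z ∧ TangentAt ω X z ∧
      ∀ v : Fin m → Cn (m + 2), ω z v = Θ z (Fin.cons (Y z) (Fin.cons (Z z) v)) := by
    filter_upwards [hU1, hU2, hha.eventually_analyticAt, hX.eventually_analyticAt,
      hY.eventually_analyticAt, hZ.eventually_analyticAt, htan, heq] with z a1 a2 a3 a4 a5 a6 a7 a8
    exact ⟨a1, a2, a3, a4, a5, a6, a7, a8⟩
  obtain ⟨R, hR, hball⟩ := Metric.eventually_nhds_iff_ball.1 hall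
  set B : Set (Cn (m + 2)) := Metric.ball 0 R with hBdef
  have hBo : IsOpen B := Metric.isOpen_ball
  have hB0 : (0 : Cn (m + 2)) ∈ B := Metric.mem_ball_self hR
  have hBn : B ∈ 𝓝 (0 : Cn (m + 2)) := hBo.mem_nhds hB0
  have hnS : ∀ z ∈ B, z ∉ S → ∃ v, ω z v ≠ 0 := by
    intro z hz hzS
    by_contra! hc
    exact hzS ⟨AlternatingMap.ext hc, (hball z hz).2.1⟩
  have hhne : ∀ z ∈ B, (∃ v, ω z v ≠ 0) → h z ≠ 0 := by
    rintro z hz ⟨v, hv⟩ h0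
    apply hv
    rw [(hball z hz).2.2.2.2.2.2.2 v, top_form_eq_det]
    change h z * _ = 0
    rw [h0, zero_mul]
  -- a point outside of the singular set
  obtain ⟨z0, hz0B, v0, hv0⟩ : ∃ z0 ∈ B, ∃ v, ω z0 v ≠ 0 := by
    have hd := dense_good S hcod (fun _ => 1) (by
      intro h; have := congrFun h 0; simp at this)
    obtain ⟨z, hz1, hz2⟩ := hd.inter_nhds_nonempty hBn
    refine ⟨z, hz2, hnS z hz2 ?_⟩
    simpa using hz1 0
  have hz0 : z0 ≠ 0 := by
    rintro rfl
    rw [hω0] at hv0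
    exact hv0 rfl
  have hD := dense_good S hcod z0 hz0
  set D : Set (Cn (m + 2)) := {z | ∀ t : ℂ, z + t • z0 ∉ S} with hDdef
  have hDS : ∀ z ∈ D, z ∉ S := fun z hz => by simpa using hz 0
  -- `h` does not vanish at the origin
  have hh0 : h 0 ≠ 0 := by
    obtain ⟨F, hF, hFD⟩ := hartogs_ext S B hBn (fun _ => 1) h (fun z => (h z)⁻¹) z0
      analyticAt_const hha
      (line_not_zero h (fun z hz => (hball z hz).2.2.1) z0 hz0B (hhne z0 hz0B ⟨v0, hv0⟩)) (by
        intro z hz hzS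
        have := hhne z hz (hnS z hz hzS)
        exact ⟨(hball z hz).2.2.1.inv this, (inv_mul_cancel₀ this).symm⟩)
    have : ∀ᶠ z in 𝓝 (0 : Cn (m + 2)), F z * h z - 1 = 0 := by
      refine zero_of_dense ((hF.mul hha).sub analyticAt_const) hD ?_
      filter_upwards [hFD, hBn] with z hz hzB hzD
      rw [hz hzD, inv_mul_cancel₀ (hhne z hzB (hnS z hzB (hDS z hzD))), sub_self]
    have h0 := this.self_of_nhds
    intro hc
    rw [hc] at h0
    simp at h0
  -- the pointwise relation
  have hrel : ∀ z ∈ B, ∀ v, ω z v • X z = Θ z (Fin.cons (X z) (Fin.cons (Z z) v)) • Y z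
      + Θ z (Fin.cons (Y z) (Fin.cons (X z) v)) • Z z := by
    intro z hz v
    obtain ⟨-, -, -, -, -, -, ht, he⟩ := hball z hz
    rw [he v]
    refine top_form_pair (Θ z) _ _ _ v fun i => ?_
    rw [← he]
    exact ht _ i (by simp)
  have hΘB : ∀ z ∈ B, HolFormAt z Θ := fun z hz => holForm_top (hball z hz).2.2.1
  have hωa : ∀ z ∈ B, ∀ v, AnalyticAt ℂ (fun w => ω w v) z := fun z hz v =>
    hol v z (hball z hz).1
  obtain ⟨f, hf⟩ := quot_exists hBo
    (fun z (v : Fin m → Cn (m + 2)) => Θ z (Fin.cons (X z) (Fin.cons (Z z) v)))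
    (fun z v => ω z v)
    (fun z hz v => analytic_pair (hΘB z hz) (hball z hz).2.2.2.1 (hball z hz).2.2.2.2.2.1 v)
    hωa (by
      intro z hz u v
      have h1 := congrArg (fun x => Θ z (Fin.cons x (Fin.cons (Z z) u))) (hrel z hz v)
      have h2 := cons_lin1 (Θ z) (ω z v) 0 (X z) 0 (Z z) u
      rw [smul_zero, add_zero, zero_mul, add_zero] at h2
      simp only [cons_lin1, cons_same, h2] at h1
      rw [h1, (hball z hz).2.2.2.2.2.2.2 u]
      ring)
  obtain ⟨g, hg⟩ := quot_exists hBo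
    (fun z (v : Fin m → Cn (m + 2)) => Θ z (Fin.cons (Y z) (Fin.cons (X z) v)))
    (fun z v => ω z v)
    (fun z hz v => analytic_pair (hΘB z hz) (hball z hz).2.2.2.2.1 (hball z hz).2.2.2.1 v)
    hωa (by
      intro z hz u v
      have h1 := congrArg (fun x => Θ z (Fin.cons (Y z) (Fin.cons x u))) (hrel z hz v)
      have h2 := cons_lin2 (Θ z) (ω z v) 0 (X z) 0 (Y z) u
      rw [smul_zero, add_zero, zero_mul, add_zero] at h2
      simp only [cons_lin2, cons_same, h2] at h1
      rw [h1, (hball z hz).2.2.2.2.2.2.2 u]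
      ring)
  have hline := line_not_zero (fun z => ω z v0) (fun z hz => hωa z hz v0) z0 hz0B hv0
  obtain ⟨F, hF, hFD⟩ := hartogs_ext S B hBn _ (fun z => ω z v0) f z0
    (analytic_pair hΘ hX hZ v0) (hωa 0 hB0 v0) hline (fun z hz hzS =>
      ⟨(hf z hz (hnS z hz hzS)).1, (hf z hz (hnS z hz hzS)).2 v0⟩)
  obtain ⟨G, hG, hGD⟩ := hartogs_ext S B hBn _ (fun z => ω z v0) g z0
    (analytic_pair hΘ hY hX v0) (hωa 0 hB0 v0) hline (fun z hz hzS =>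
      ⟨(hg z hz (hnS z hz hzS)).1, (hg z hz (hnS z hz hzS)).2 v0⟩)
  have hXFG : ∀ᶠ z in 𝓝 (0 : Cn (m + 2)), X z = F z • Y z + G z • Z z := by
    have : ∀ᶠ z in 𝓝 (0 : Cn (m + 2)), X z - (F z • Y z + G z • Z z) = 0 := by
      refine zero_of_dense (hX.sub ((hF.smul hY).add (hG.smul hZ))) hD ?_
      filter_upwards [hFD, hGD, hBn] with z hz1 hz2 hzB hzD
      have hn := hnS z hzB (hDS z hzD)
      rw [hz1 hzD, hz2 hzD]
      obtain ⟨v, hv⟩ := id hn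
      have h1 := hrel z hzB v
      have h2 := (hf z hzB hn).2 v
      have h3 := (hg z hzB hn).2 v
      rw [h2, h3] at h1
      refine (smul_right_injective _ hv) ?_
      simp only
      rw [smul_sub, h1, smul_add, smul_smul, smul_smul, smul_zero, mul_comm (f z),
        mul_comm (g z), sub_self]
    filter_upwards [this] with z hz using sub_eq_zero.1 hz
  -- holomorphic contraction
  have hcontr : ∀ W : VF (m + 2), AnalyticAt ℂ W 0 → ∀ u : Fin (m + 1) → Cn (m + 2),
      AnalyticAt ℂ (fun z => (Θ z).curryLeft (W z) u) 0 := by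
    intro W hW u
    have := analytic_pair hΘ hW (analyticAt_const (v := u 0)) (Fin.tail u)
    convert this using 2 with z
    rw [AlternatingMap.curryLeft_apply_apply]
    congr 2
    exact (Fin.cons_self_tail u).symm
  by_cases hF0 : F 0 = 0
  · by_cases hG0 : G 0 = 0
    · exfalso
      have hder : HasFDerivAt X (((fderiv ℂ F 0).smulRight (Y 0))
          + ((fderiv ℂ G 0).smulRight (Z 0))) 0 := by
        have h1 := (hF.differentiableAt.hasFDerivAt.smul hY.differentiableAt.hasFDerivAt).add
          (hG.differentiableAt.hasFDerivAt.smul hZ.differentiableAt.hasFDerivAt)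
        rw [hF0, hG0, zero_smul, zero_smul, zero_add, zero_add] at h1
        exact h1.congr_of_eventuallyEq hXFG
      have hrange : LinearMap.range (fderiv ℂ X 0).toLinearMap ≤
          Submodule.span ℂ (Set.range ![Y 0, Z 0]) := by
        rw [hder.fderiv]
        rintro _ ⟨x, rfl⟩
        simp only [Matrix.range_cons, Matrix.range_empty, Set.union_empty]
        refine Submodule.add_mem _ (Submodule.smul_mem _ _ (Submodule.subset_span ?_))
          (Submodule.smul_mem _ _ (Submodule.subset_span ?_))
        · simp
        · simp
      have hfr : 2 ≤ Set.finrank ℂ (Set.range ![Y 0, Z 0]) :=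
        hrk.trans (Submodule.finrank_mono hrange)
      have hli : LinearIndependent ℂ ![Y 0, Z 0] := by
        rw [linearIndependent_iff_card_le_finrank_span]
        simpa using hfr
      obtain ⟨v, hv⟩ := exists_top_ne_zero (Θ 0) hh0 (Y 0) (Z 0) hli
      rw [← (hball 0 hB0).2.2.2.2.2.2.2 v, hω0] at hv
      exact hv rfl
    · refine ⟨fun z => (G z)⁻¹ • (Θ z).curryLeft (Y z), fun u => ?_, ?_⟩
      · exact (hG.inv hG0).mul (hcontr Y hY u)
      · filter_upwards [hXFG, heq, hG.continuousAt.eventually_ne hG0] with z h1 h2 h3 v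
        have h4 := cons_lin2 (Θ z) (F z) (G z) (Y z) (Z z) (Y z) v
        rw [← h1, cons_same] at h4
        rw [AlternatingMap.smul_apply, AlternatingMap.curryLeft_apply_apply]
        change _ = _ • Θ z (Fin.cons (Y z) (Fin.cons (X z) v))
        rw [h4, h2 v, smul_eq_mul]
        field_simp
        ring
  · refine ⟨fun z => (-(F z)⁻¹) • (Θ z).curryLeft (Z z), fun u => ?_, ?_⟩
    · exact (hF.inv hF0).neg.mul (hcontr Z hZ u)
    · filter_upwards [hXFG, heq, hF.continuousAt.eventually_ne hF0] with z h1 h2 h3 v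
      have h4 := cons_lin1 (Θ z) (F z) (G z) (Y z) (Z z) (Z z) v
      rw [← h1, cons_same] at h4
      rw [AlternatingMap.smul_apply, AlternatingMap.curryLeft_apply_apply]
      change _ = _ • Θ z (Fin.cons (Z z) (Fin.cons (X z) v))
      rw [cons_swap, h4, h2 v, smul_eq_mul]
      field_simp
      ring

end Aux

/-- Corollary 4.4: Let `ω` be a germ of holomorphic `(n-2)`-form at
`0 ∈ ℂⁿ` with `ω 0 = 0`, defining a germ of singular two-dimensional distribution with
locally free tangent sheaf, and `X` a germ of vector field with `i_X ω = 0`. If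
`rank (DX 0) ≥ 2` then `X` divides `ω`. -/
theorem statement_10 (n m : ℕ) (hn : 3 ≤ n) (hm : n = m + 2)
    (ω : Form n m) (hω0 : ω 0 = 0) (hdist : IsGermDist n m ω)
    (hfree : GermLocFree2 n m ω)
    (X : VF n) (hX : AnalyticAt ℂ X 0)
    (htan : ∀ᶠ z in 𝓝 (0 : Cn n), TangentAt ω X z)
    (hrk : 2 ≤ rkAt X 0) :
    DividesAt X ω 0 := by
  subst hm
  exact statement_aux m (by omega) ω hω0 hdist hfree X hX htan hrk
end

section
/- Let D be a two-dimensional singular holomorphic distribution on ℙ^n, n ≥ 3 (not necessarily with locally free tangent sheaf), and let G be a one-dimensional foliation on ℙ^n tangent to D. If the linear rank of G is at least 3, then G locally divides D at every point; in particular, T_D splits as a direct sum of two line bundles. -/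
open Topology Filter Set
open scoped ENNReal Manifold

namespace S12
open MvPolynomial

/-! ### Local regularity -/
section LocalReg
set_option linter.unusedSectionVars false
variable {σ : Type*} [Finite σ]

theorem memI_iff (k : ℕ) (p : MvPolynomial σ ℂ) :
    p ∈ idealOfVars σ ℂ ^ k ↔ ∀ x : σ →₀ ℕ, x.degree < k → p.coeff x = 0 := by
  rw [mem_pow_idealOfVars_iff]
  constructor
  · intro h x hx
    by_contra hc
    have := h x (mem_support_iff.2 hc)
    omega
  · intro h x hx
    by_contra hc
    exact (mem_support_iff.1 hx) (h x (by omega))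

theorem deg_add_single (x : σ →₀ ℕ) (i : σ) : (x + Finsupp.single i 1).degree = x.degree + 1 := by
  simp

theorem X_memI (i : σ) : (X i : MvPolynomial σ ℂ) ∈ idealOfVars σ ℂ :=
  Ideal.subset_span ⟨i, rfl⟩

theorem cancelX {i : σ} {k : ℕ} {p : MvPolynomial σ ℂ} (h : p * X i ∈ idealOfVars σ ℂ ^ (k+1)) :
    p ∈ idealOfVars σ ℂ ^ k := by
  rw [memI_iff] at *
  intro x hx
  have := h (x + Finsupp.single i 1) (by simp; omega)
  rwa [coeff_mul_X] at this

theorem div_mem {i : σ} {k : ℕ} {p : MvPolynomial σ ℂ} (h : p ∈ idealOfVars σ ℂ ^ k) :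
    p.divMonomial (Finsupp.single i 1) ∈ idealOfVars σ ℂ ^ (k-1) := by
  rw [memI_iff] at *
  intro x hx
  rw [coeff_divMonomial]
  exact h _ (by simp; omega)

theorem div_spec (i : σ) (p : MvPolynomial σ ℂ) :
    p - p.divMonomial (Finsupp.single i 1) * X i = p.modMonomial (Finsupp.single i 1) := by
  have := divMonomial_add_modMonomial_single p i
  linear_combination -(1:MvPolynomial σ ℂ) * this

theorem mod_coeff_of_ne (i : σ) (p : MvPolynomial σ ℂ) (x : σ →₀ ℕ) (hx : x i ≠ 0) :
    (p.modMonomial (Finsupp.single i 1)).coeff x = 0 := by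
  apply coeff_modMonomial_of_le
  rw [Finsupp.single_le_iff]; omega

theorem mod_coeff_of_eq (i : σ) (p : MvPolynomial σ ℂ) (x : σ →₀ ℕ) (hx : x i = 0) :
    (p.modMonomial (Finsupp.single i 1)).coeff x = p.coeff x := by
  apply coeff_modMonomial_of_not_le
  rw [Finsupp.single_le_iff]; omega

theorem coeff_mul_X_zero (i : σ) (p : MvPolynomial σ ℂ) (x : σ →₀ ℕ) (hx : x i = 0) :
    (p * X i).coeff x = 0 := by
  classical
  rw [coeff_mul_X', if_neg]
  simpa using hx

/-- syzygy step -/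
theorem L2 {i1 i2 : σ} (h12 : i1 ≠ i2) {j : ℕ} {u v : MvPolynomial σ ℂ}
    (hu : u ∈ idealOfVars σ ℂ ^ j)
    (h : u * X i1 + v * X i2 ∈ idealOfVars σ ℂ ^ (j+2)) :
    ∃ w ∈ idealOfVars σ ℂ ^ (j-1), u - w * X i2 ∈ idealOfVars σ ℂ ^ (j+1) ∧
      v + w * X i1 ∈ idealOfVars σ ℂ ^ (j+1) := by
  refine ⟨u.divMonomial (Finsupp.single i2 1), div_mem hu, ?_⟩
  have h1 : u - u.divMonomial (Finsupp.single i2 1) * X i2 ∈ idealOfVars σ ℂ ^ (j+1) := by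
    rw [div_spec, memI_iff]
    intro x hx
    by_cases hx2 : x i2 = 0
    · rw [mod_coeff_of_eq _ _ _ hx2]
      have := (memI_iff _ _).1 h (x + Finsupp.single i1 1) (by simp; omega)
      rw [coeff_add, coeff_mul_X, coeff_mul_X_zero i2 v _ (by simp [hx2, h12]), add_zero] at this
      exact this
    · exact mod_coeff_of_ne _ _ _ hx2
  refine ⟨h1, ?_⟩
  apply cancelX (i := i2)
  have := Ideal.sub_mem _ h (show _ ∈ idealOfVars σ ℂ ^ (j+2) from (pow_succ (idealOfVars σ ℂ) (j+1)) ▸ Ideal.mul_mem_mul h1 (X_memI i1))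
  convert this using 1
  ring

theorem L3 {i1 i2 i3 : σ} (h13 : i1 ≠ i3) (h23 : i2 ≠ i3) {j : ℕ}
    {h u v : MvPolynomial σ ℂ} (hh : h ∈ idealOfVars σ ℂ ^ j)
    (he : h * X i3 - (u * X i1 + v * X i2) ∈ idealOfVars σ ℂ ^ (j+2)) :
    ∃ α ∈ idealOfVars σ ℂ ^ (j-1), ∃ β ∈ idealOfVars σ ℂ ^ (j-1),
      h - α * X i1 - β * X i2 ∈ idealOfVars σ ℂ ^ (j+1) := by
  have hr : h.modMonomial (Finsupp.single i1 1) ∈ idealOfVars σ ℂ ^ j := by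
    rw [memI_iff]
    intro x hx
    by_cases hx1 : x i1 = 0
    · rw [mod_coeff_of_eq _ _ _ hx1]; exact (memI_iff _ _).1 hh x hx
    · exact mod_coeff_of_ne _ _ _ hx1
  refine ⟨h.divMonomial (Finsupp.single i1 1), div_mem hh,
    (h.modMonomial (Finsupp.single i1 1)).divMonomial (Finsupp.single i2 1), div_mem hr, ?_⟩
  rw [div_spec, div_spec, memI_iff]
  intro x hx
  by_cases hx2 : x i2 = 0
  swap
  · exact mod_coeff_of_ne _ _ _ hx2
  rw [mod_coeff_of_eq _ _ _ hx2]
  by_cases hx1 : x i1 = 0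
  swap
  · exact mod_coeff_of_ne _ _ _ hx1
  rw [mod_coeff_of_eq _ _ _ hx1]
  have := (memI_iff _ _).1 he (x + Finsupp.single i3 1) (by simp; omega)
  rw [coeff_sub, coeff_add, coeff_mul_X, coeff_mul_X_zero i2 v _ (by simp [hx2, h23.symm]),
    coeff_mul_X_zero i1 u _ (by simp [hx1, h13.symm])] at this
  simpa using this

theorem L3' {i1 i3 : σ} (h13 : i1 ≠ i3) {j : ℕ}
    {h u : MvPolynomial σ ℂ} (hh : h ∈ idealOfVars σ ℂ ^ j)
    (he : h * X i3 - u * X i1 ∈ idealOfVars σ ℂ ^ (j+2)) :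
    ∃ α ∈ idealOfVars σ ℂ ^ (j-1), h - α * X i1 ∈ idealOfVars σ ℂ ^ (j+1) := by
  refine ⟨h.divMonomial (Finsupp.single i1 1), div_mem hh, ?_⟩
  rw [div_spec, memI_iff]
  intro x hx
  by_cases hx1 : x i1 = 0
  swap
  · exact mod_coeff_of_ne _ _ _ hx1
  rw [mod_coeff_of_eq _ _ _ hx1]
  have := (memI_iff _ _).1 he (x + Finsupp.single i3 1) (by simp; omega)
  rw [coeff_sub, coeff_mul_X, 
    coeff_mul_X_zero i1 u _ (by simp [hx1, h13.symm])] at this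
  simpa using this

theorem mulmem {a b c : ℕ} (habc : c ≤ a + b) {p q : MvPolynomial σ ℂ}
    (hp : p ∈ idealOfVars σ ℂ ^ a) (hq : q ∈ idealOfVars σ ℂ ^ b) :
    p * q ∈ idealOfVars σ ℂ ^ c :=
  Ideal.pow_le_pow_right habc (pow_add (idealOfVars σ ℂ) a b ▸ Ideal.mul_mem_mul hp hq)

theorem syz2 {i1 i2 : σ} (h12 : i1 ≠ i2) {f1 f2 : MvPolynomial σ ℂ}
    (hf1 : f1 - X i1 ∈ idealOfVars σ ℂ ^ 2) (hf2 : f2 - X i2 ∈ idealOfVars σ ℂ ^ 2)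
    (k : ℕ) : ∀ {u v : MvPolynomial σ ℂ}, u * f1 + v * f2 ∈ idealOfVars σ ℂ ^ (k+1) →
    ∃ w, u - w * f2 ∈ idealOfVars σ ℂ ^ k ∧ v + w * f1 ∈ idealOfVars σ ℂ ^ k := by
  induction k with
  | zero => intro u v _; exact ⟨0, by simp, by simp⟩
  | succ k ih =>
    intro u v h
    obtain ⟨w, hu, hv⟩ := ih (Ideal.pow_le_pow_right (by omega) h)
    have h1 : (u - w * f2) * X i1 + (v + w * f1) * X i2 ∈ idealOfVars σ ℂ ^ (k+2) := by
      have := Ideal.sub_mem _ (Ideal.sub_mem _ h (mulmem (c := k+2) le_rfl hu hf1))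
        (mulmem (c := k+2) le_rfl hv hf2)
      convert this using 1
      ring
    obtain ⟨w', hw', h2, h3⟩ := L2 h12 hu h1
    refine ⟨w + w', ?_, ?_⟩
    · have := Ideal.sub_mem _ h2 (mulmem (c := k+1) (by omega) hw' hf2)
      convert this using 1
      ring
    · have := Ideal.add_mem _ h3 (mulmem (c := k+1) (by omega) hw' hf1)
      convert this using 1
      ring

theorem syz1 {i1 : σ} {f1 : MvPolynomial σ ℂ}
    (hf1 : f1 - X i1 ∈ idealOfVars σ ℂ ^ 2)
    (k : ℕ) : ∀ {u : MvPolynomial σ ℂ}, u * f1 ∈ idealOfVars σ ℂ ^ (k+1) →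
    u ∈ idealOfVars σ ℂ ^ k := by
  induction k with
  | zero => intro u  _; simp
  | succ k ih =>
    intro u h
    have hu := ih (Ideal.pow_le_pow_right (by omega) h)
    apply cancelX (i := i1)
    have := Ideal.sub_mem _ h (mulmem (c := k+2) le_rfl hu hf1)
    convert this using 1
    ring

theorem lin_mem {i1 : σ} {f1 : MvPolynomial σ ℂ}
    (hf1 : f1 - X i1 ∈ idealOfVars σ ℂ ^ 2) : f1 ∈ idealOfVars σ ℂ ^ 1 := by
  have := Ideal.add_mem _ (Ideal.pow_le_pow_right (show 1 ≤ 2 by omega) hf1)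
    ((pow_one (idealOfVars σ ℂ)).symm ▸ X_memI i1)
  simpa using this

theorem krull (I : Ideal (MvPolynomial σ ℂ)) (g : MvPolynomial σ ℂ)
    (h : ∀ k, ∃ b ∈ I, g - b ∈ idealOfVars σ ℂ ^ k) :
    ∃ s, eval 0 s ≠ 0 ∧ s * g ∈ I := by
  have h1 : (Ideal.Quotient.mk I g) ∈ (⨅ i : ℕ, idealOfVars σ ℂ ^ i • ⊤ :
      Submodule (MvPolynomial σ ℂ) (MvPolynomial σ ℂ ⧸ I)) := by
    rw [Submodule.mem_iInf]
    intro k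
    obtain ⟨b, hb, hk⟩ := h k
    have : Ideal.Quotient.mk I g = (g - b) • (1 : MvPolynomial σ ℂ ⧸ I) := by
      change _ = Ideal.Quotient.mk I ((g - b) • (1 : MvPolynomial σ ℂ))
      rw [smul_eq_mul, mul_one, map_sub, Ideal.Quotient.eq_zero_iff_mem.2 hb, sub_zero]
    rw [this]
    exact Submodule.smul_mem_smul hk trivial
  obtain ⟨r, hr⟩ := (Ideal.mem_iInf_smul_pow_eq_bot_iff _ _).1 h1
  refine ⟨1 - r, ?_, ?_⟩
  · have : eval (0 : σ → ℂ) r.1 = 0 := by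
      have h2 := (memI_iff 1 r.1).1 (by simp) 0 (by simp)
      rw [← h2, ← constantCoeff_eq]
      exact congrFun (congrArg _ eval_zero) _
    rw [map_sub, this, map_one, sub_zero]
    exact one_ne_zero
  · rw [← Ideal.Quotient.eq_zero_iff_mem, sub_mul, one_mul, map_sub, sub_eq_zero]
    exact hr.symm

/-- `f1,f2,f3` is a regular sequence after localization at `T`. -/
structure RegSeq {A : Type*} [CommRing A] (T : Submonoid A) (f1 f2 f3 : A) : Prop where
  ne : f1 ≠ 0
  r2 : ∀ g, f1 ∣ f2 * g → ∃ t ∈ T, f1 ∣ t * g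
  r3 : ∀ g u v, f3 * g = u * f1 + v * f2 → ∃ t ∈ T, ∃ u' v', t * g = u' * f1 + v' * f2

/-- polynomials non vanishing at `q` -/
def nv (q : σ → ℂ) : Submonoid (MvPolynomial σ ℂ) where
  carrier := {s | eval q s ≠ 0}
  mul_mem' := by
    intro a b ha hb
    simp only [Set.mem_ofPred_eq, map_mul] at *
    exact mul_ne_zero ha hb
  one_mem' := by simp

theorem regSeq0 {i1 i2 i3 : σ} (h12 : i1 ≠ i2) (h13 : i1 ≠ i3) (h23 : i2 ≠ i3)
    {f1 f2 f3 : MvPolynomial σ ℂ}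
    (hf1 : f1 - X i1 ∈ idealOfVars σ ℂ ^ 2) (hf2 : f2 - X i2 ∈ idealOfVars σ ℂ ^ 2)
    (hf3 : f3 - X i3 ∈ idealOfVars σ ℂ ^ 2) : RegSeq (nv 0) f1 f2 f3 where
  ne := by
    rintro rfl
    have := (memI_iff _ _).1 hf1 (Finsupp.single i1 1) (by simp)
    simp at this
  r2 := by
    intro g hg
    have hne : f1 ∣ f2 * g := hg
    have key : ∀ k, ∃ a, g - a * f1 ∈ idealOfVars σ ℂ ^ k := by
      intro k
      induction k with
      | zero => exact ⟨0, by simp⟩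
      | succ k ih =>
        obtain ⟨a, ha⟩ := ih
        obtain ⟨u0, hu0⟩ := hg
        obtain ⟨u, hu⟩ : ∃ u, f2 * (g - a * f1) = u * f1 := ⟨u0 - f2 * a, by linear_combination hu0⟩
        have h1 : u ∈ idealOfVars σ ℂ ^ k := by
          apply syz1 hf1
          rw [← hu]
          exact mulmem (by omega) (lin_mem hf2) ha
        have h2 : (g - a * f1) * X i2 - u * X i1 ∈ idealOfVars σ ℂ ^ (k+2) := by
          have := Ideal.sub_mem _ (mulmem (c := k+2) le_rfl h1 hf1)
            (mulmem (c := k+2) le_rfl ha hf2)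
          convert this using 1
          linear_combination hu
        obtain ⟨α, hα, h3⟩ := L3' h12 ha h2
        refine ⟨a + α, ?_⟩
        have := Ideal.sub_mem _ h3 (mulmem (c := k+1) (by omega) hα hf1)
        convert this using 1
        ring
    obtain ⟨s, hs, hs'⟩ := krull (Ideal.span {f1}) g (fun k => by
      obtain ⟨a, ha⟩ := key k
      exact ⟨a * f1, Ideal.mul_mem_left _ _ (Ideal.mem_span_singleton_self _), ha⟩)
    exact ⟨s, hs, Ideal.mem_span_singleton.1 hs'⟩
  r3 := by
    intro g u0 v0 hg
    have key : ∀ k, ∃ a b, g - (a * f1 + b * f2) ∈ idealOfVars σ ℂ ^ k := by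
      intro k
      induction k with
      | zero => exact ⟨0, 0, by simp⟩
      | succ k ih =>
        obtain ⟨a, b, ha⟩ := ih
        obtain ⟨u, v, hu⟩ : ∃ u v, f3 * (g - (a * f1 + b * f2)) = u * f1 + v * f2 :=
          ⟨u0 - f3 * a, v0 - f3 * b, by linear_combination hg⟩
        obtain ⟨w, h1, h1'⟩ : ∃ w, u - w * f2 ∈ idealOfVars σ ℂ ^ k ∧
            v + w * f1 ∈ idealOfVars σ ℂ ^ k := by
          apply syz2 h12 hf1 hf2
          rw [← hu]
          exact mulmem (by omega) (lin_mem hf3) ha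
        have h2 : (g - (a * f1 + b * f2)) * X i3 - ((u - w * f2) * X i1 + (v + w * f1) * X i2)
            ∈ idealOfVars σ ℂ ^ (k+2) := by
          have := Ideal.sub_mem _ (Ideal.add_mem _ (mulmem (c := k+2) le_rfl h1 hf1)
            (mulmem (c := k+2) le_rfl h1' hf2)) (mulmem (c := k+2) le_rfl ha hf3)
          convert this using 1
          linear_combination hu
        obtain ⟨α, hα, β, hβ, h3⟩ := L3 h13 h23 ha h2
        refine ⟨a + α, b + β, ?_⟩
        have := Ideal.sub_mem _ (Ideal.sub_mem _ h3 (mulmem (c := k+1) (by omega) hα hf1))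
          (mulmem (c := k+1) (by omega) hβ hf2)
        convert this using 1
        ring
    obtain ⟨s, hs, hs'⟩ := krull (Ideal.span {f1, f2}) g (fun k => by
      obtain ⟨a, b, ha⟩ := key k
      exact ⟨a * f1 + b * f2, Ideal.mem_span_pair.2 ⟨a, b, rfl⟩, ha⟩)
    obtain ⟨a, b, hab⟩ := Ideal.mem_span_pair.1 hs'
    exact ⟨s, hs, a, b, hab.symm⟩

end LocalReg
end S12

namespace S12
open MvPolynomial

theorem RegSeq.pull {A B : Type*} [CommRing A] [CommRing B] (φ : A →+* B) (ψ : B →+* A)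
    (h : ∀ a, ψ (φ a) = a) {T : Submonoid A} {T' : Submonoid B} (hT : ∀ t ∈ T', ψ t ∈ T)
    {f1 f2 f3 : A} (H : RegSeq T' (φ f1) (φ f2) (φ f3)) : RegSeq T f1 f2 f3 := by
  refine ⟨fun h0 => H.ne (by rw [h0, map_zero]), fun g hg => ?_, fun g u v e => ?_⟩
  · obtain ⟨t, ht, htg⟩ := H.r2 (φ g) (by rw [← map_mul]; exact map_dvd φ hg)
    refine ⟨ψ t, hT t ht, ?_⟩
    have := map_dvd ψ htg
    rwa [map_mul, h, h] at this
  · obtain ⟨t, ht, u', v', e'⟩ := H.r3 (φ g) (φ u) (φ v) (by rw [← map_mul, e, map_add, map_mul, map_mul])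
    refine ⟨ψ t, hT t ht, ψ u', ψ v', ?_⟩
    have := congrArg ψ e'
    simpa only [map_mul, map_add, h] using this

theorem taylor {N : ℕ} {τ : Type*} [Fintype τ] (q : Fin N → ℂ) (b : τ → Fin N → ℂ)
    (f : MvPolynomial (Fin N) ℂ) :
    ∃ L : (Fin N → ℂ) →L[ℂ] ℂ, HasFDerivAt (fun z => eval z f) L q ∧
      aeval (fun i => C (q i) + ∑ j, C (b j i) * (X j : MvPolynomial τ ℂ)) f - C (eval q f)
        - ∑ j, C (L (b j)) * X j ∈ idealOfVars τ ℂ ^ 2 := by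
  induction f using MvPolynomial.induction_on with
  | C a =>
    refine ⟨0, ?_, ?_⟩
    · simpa using hasFDerivAt_const a q
    · simp [MvPolynomial.algebraMap_eq]
  | add f g hf hg =>
    obtain ⟨L, h1, h2⟩ := hf
    obtain ⟨M, h3, h4⟩ := hg
    refine ⟨L + M, ?_, ?_⟩
    · simp only [map_add]; exact h1.add h3
    · convert add_mem h2 h4 using 1
      simp only [map_add, _root_.add_apply, add_mul, Finset.sum_add_distrib]
      ring
  | mul_X f i hf =>
    obtain ⟨L, h1, h2⟩ := hf
    refine ⟨eval q f • ContinuousLinearMap.proj i + q i • L, ?_, ?_⟩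
    · have := h1.mul (hasFDerivAt_apply (𝕜 := ℂ) i q)
      simp only [map_mul, eval_X]; exact this
    · set φ := aeval (R := ℂ) (fun i => C (q i) + ∑ j, C (b j i) * (X j : MvPolynomial τ ℂ))
      have hl : ∀ c : τ → ℂ, ∑ j, C (c j) * (X j : MvPolynomial τ ℂ) ∈ idealOfVars τ ℂ := fun c =>
        Ideal.sum_mem _ fun j _ => Ideal.mul_mem_left _ _ (X_memI j)
      have e1 := Ideal.mul_mem_right (φ (X i)) _ h2
      have e2 : (∑ j, C (L (b j)) * (X j : MvPolynomial τ ℂ)) * (∑ j, C (b j i) * X j) ∈ idealOfVars τ ℂ ^ 2 := by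
        rw [pow_two]; exact Ideal.mul_mem_mul (hl _) (hl _)
      convert add_mem e1 e2 using 1
      have e3 : φ (X i) = C (q i) + ∑ j, C (b j i) * (X j : MvPolynomial τ ℂ) := by simp [φ]
      have e4 : (∑ j, C ((eval q f • ContinuousLinearMap.proj i + q i • L : (Fin N → ℂ) →L[ℂ] ℂ) (b j)) * (X j : MvPolynomial τ ℂ))
         = C (eval q f) * (∑ j, C (b j i) * X j) + C (q i) * ∑ j, C (L (b j)) * X j := by
        rw [Finset.mul_sum, Finset.mul_sum, ← Finset.sum_add_distrib]
        refine Finset.sum_congr rfl fun j _ => ?_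
        simp only [_root_.add_apply, _root_.smul_apply, smul_eq_mul, map_add, map_mul, ContinuousLinearMap.proj_apply]
        ring
      rw [e4, map_mul, map_mul, e3, eval_X, map_mul]
      ring

theorem evalDiff {N : ℕ} (f : MvPolynomial (Fin N) ℂ) (q : Fin N → ℂ) :
    DifferentiableAt ℂ (fun z => eval z f) q := by
  obtain ⟨L, h, -⟩ := taylor (τ := Fin 0) q (fun _ => 0) f
  exact h.differentiableAt

/-- Local regularity at a point. -/
theorem regSeqAt {N : ℕ} (q : Fin N → ℂ) (f : Fin 3 → MvPolynomial (Fin N) ℂ) (u : Fin 3 → Fin N → ℂ)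
    (h0 : ∀ k, eval q (f k) = 0)
    (hd : ∀ k l, fderiv ℂ (fun z => eval z (f k)) q (u l) = if k = l then 1 else 0) :
    RegSeq (nv q) (f 0) (f 1) (f 2) := by
  set Lm : (Fin N → ℂ) →ₗ[ℂ] (Fin 3 → ℂ) :=
    LinearMap.pi fun k => (fderiv ℂ (fun z => eval z (f k)) q).toLinearMap with hLm
  have hLu : ∀ c : Fin 3 → ℂ, Lm (∑ l, c l • u l) = c := by
    intro c; ext k
    simp [hLm, hd]
  let e : (LinearMap.ker Lm × (Fin 3 → ℂ)) ≃ₗ[ℂ] (Fin N → ℂ) :=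
    { toFun := fun p => p.1 + ∑ l, p.2 l • u l
      map_add' := by
        intro p p'
        simp only [Prod.fst_add, Prod.snd_add, Pi.add_apply, add_smul, Finset.sum_add_distrib, Submodule.coe_add]
        abel
      map_smul' := by
        intro a p
        simp [smul_add, Finset.smul_sum, mul_smul]
      invFun := fun x => (⟨x - ∑ l, Lm x l • u l, by
        rw [LinearMap.mem_ker, map_sub, hLu (Lm x), sub_self]⟩, Lm x)
      left_inv := by
        rintro ⟨⟨k, hk⟩, c⟩
        rw [LinearMap.mem_ker] at hk
        have : Lm (k + ∑ l, c l • u l) = c := by rw [map_add, hLu, hk, zero_add]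
        ext1
        · ext1
          simp only [this]; abel
        · exact this
      right_inv := by
        intro x; simp }
  let b := ((Module.finBasis ℂ (LinearMap.ker Lm)).prod (Pi.basisFun ℂ (Fin 3))).map e
  have hb : ∀ k j, fderiv ℂ (fun z => eval z (f k)) q (b j) = if j = Sum.inr k then 1 else 0 := by
    intro k j
    have : fderiv ℂ (fun z => eval z (f k)) q (b j) = Lm (b j) k := rfl
    rw [this]
    rcases j with j | j
    · have : Lm (b (Sum.inl j)) = 0 := by
        have : b (Sum.inl j) = (Module.finBasis ℂ (LinearMap.ker Lm) j : Fin N → ℂ) := by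
          simp [b, e]
        rw [this]; exact (Module.finBasis ℂ (LinearMap.ker Lm) j).2
      rw [this]; simp
    · have : b (Sum.inr j) = ∑ l, (Pi.single j 1 : Fin 3 → ℂ) l • u l := by
        simp [b, e]
      rw [this, hLu]
      simp [Pi.single_apply, eq_comm]
  let φ : MvPolynomial (Fin N) ℂ →ₐ[ℂ] MvPolynomial (Fin (Module.finrank ℂ (LinearMap.ker Lm)) ⊕ Fin 3) ℂ :=
    aeval (R := ℂ) (fun i => C (q i) + ∑ j, C (b j i) * X j)
  let ψ : MvPolynomial (Fin (Module.finrank ℂ (LinearMap.ker Lm)) ⊕ Fin 3) ℂ →ₐ[ℂ] MvPolynomial (Fin N) ℂ :=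
    aeval (R := ℂ) (fun j => ∑ i, C (b.repr (Pi.single i 1) j) * (X i - C (q i)))
  have hψφ : ψ.comp φ = AlgHom.id ℂ _ := by
    ext1 i
    simp only [AlgHom.comp_apply, φ, aeval_X, map_add, map_sum, map_mul, AlgHom.id_apply]
    have hC : ∀ a : ℂ, ψ (C a) = C a := fun a => ψ.commutes a
    simp only [hC, ψ, aeval_X]
    simp only [Finset.mul_sum]
    rw [Finset.sum_comm]
    have : ∀ i', ∑ j, C (b j i) * (C (b.repr (Pi.single i' 1) j) * (X i' - C (q i')))
        = (if i = i' then 1 else 0) * (X i' - C (q i') : MvPolynomial (Fin N) ℂ) := by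
      intro i'
      have h1 := congrFun (b.sum_repr (Pi.single i' 1)) i
      rw [Finset.sum_apply] at h1
      simp only [Pi.smul_apply, smul_eq_mul] at h1
      have h2 := congrArg (C (σ := Fin N)) h1
      rw [map_sum] at h2
      simp_rw [← mul_assoc, ← map_mul]
      rw [← Finset.sum_mul]
      congr 1
      rw [show (∑ x, C (b x i * (b.repr (Pi.single i' 1)) x) : MvPolynomial (Fin N) ℂ) = _ from
        (Finset.sum_congr rfl fun x _ => by rw [mul_comm]).trans h2]
      by_cases h : i = i' <;> simp [h, Pi.single_apply]
    simp_rw [this]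
    simp
  have hψ : ∀ g, eval q (ψ g) = eval 0 g := by
    intro g
    have : (aeval (R := ℂ) q).comp ψ = aeval (R := ℂ) (0 : (Fin (Module.finrank ℂ (LinearMap.ker Lm)) ⊕ Fin 3) → ℂ) := by
      ext j
      simp [ψ]
    have := congrArg (fun F => F g) this
    simpa [MvPolynomial.aeval_eq_eval, MvPolynomial.coe_aeval_eq_eval] using this
  have hφ : ∀ k, φ (f k) - X (Sum.inr k) ∈ idealOfVars _ ℂ ^ 2 := by
    intro k
    obtain ⟨L, h1, h2⟩ := taylor q b (f k)
    rw [← h1.fderiv] at h2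
    simp only [hb, h0] at h2
    convert h2 using 1
    simp [φ]
  have H := regSeq0 (i1 := Sum.inr 0) (i2 := Sum.inr 1) (i3 := Sum.inr 2) (by simp) (by simp) (by simp)
    (hφ 0) (hφ 1) (hφ 2)
  refine RegSeq.pull φ.toRingHom ψ.toRingHom (fun a => congrArg (fun F => F a) hψφ) ?_ H
  intro t ht
  change eval q (ψ t) ≠ 0
  rw [hψ]; exact ht

end S12

namespace S12
open MvPolynomial

theorem regSeqGlobal {σ : Type*} {i0 i1 i2 : σ} (h01 : i0 ≠ i1) (h02 : i0 ≠ i2) (h12 : i1 ≠ i2) (k : ℕ) :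
    RegSeq (⊥ : Submonoid (MvPolynomial σ ℂ)) (X i0 ^ k) (X i1 ^ k) (X i2 ^ k) := by
  have hX : ∀ i : σ, (X i ^ k : MvPolynomial σ ℂ) = monomial (Finsupp.single i k) 1 := fun i => by
    rw [X_pow_eq_monomial]
  refine ⟨pow_ne_zero _ (X_ne_zero i0), fun g hg => ?_, fun g u v e => ?_⟩
  · refine ⟨1, one_mem _, ?_⟩
    rw [one_mul]
    refine (X_prime (R := ℂ) (i := i0)).pow_dvd_of_dvd_mul_left k ?_ hg
    intro h
    have := (X_prime (R := ℂ) (i := i0)).dvd_of_dvd_pow h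
    rw [X_dvd_X] at this
    simp_all
  · refine ⟨1, one_mem _, ?_⟩
    have h1 : X i2 ^ k * g ∈ Ideal.span ((fun s => monomial s (1:ℂ)) '' {Finsupp.single i0 k, Finsupp.single i1 k}) := by
      rw [Set.image_pair, ← hX, ← hX, e]
      exact Ideal.mem_span_pair.2 ⟨u, v, rfl⟩
    have h2 : g ∈ Ideal.span ((fun s => monomial s (1:ℂ)) '' {Finsupp.single i0 k, Finsupp.single i1 k}) := by
      rw [mem_ideal_span_monomial_image] at h1 ⊢
      intro m hm
      obtain ⟨s, hs, hle⟩ := h1 (Finsupp.single i2 k + m) (by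
        rw [mem_support_iff, hX, coeff_monomial_mul, one_mul]; exact mem_support_iff.1 hm)
      refine ⟨s, hs, ?_⟩
      rcases hs with rfl | rfl
      · rw [Finsupp.single_le_iff] at hle ⊢
        simpa [Finsupp.single_apply, h02.symm] using hle
      · rw [Finsupp.single_le_iff] at hle ⊢
        simpa [Finsupp.single_apply, h12.symm] using hle
    rw [Set.image_pair, ← hX, ← hX] at h2
    obtain ⟨a, b, h⟩ := Ideal.mem_span_pair.1 h2
    exact ⟨a, b, by rw [one_mul, h]⟩

/-- closure lemma -/
theorem one_mem_of {N : ℕ} (hN : 3 ≤ N) (J : Ideal (MvPolynomial (Fin N) ℂ))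
    (hJ : ∀ (T : Submonoid (MvPolynomial (Fin N) ℂ)) (f1 f2 f3 : MvPolynomial (Fin N) ℂ),
      RegSeq T f1 f2 f3 → f1 ∈ J → f2 ∈ J → f3 ∈ J → ∃ t ∈ T, t ∈ J)
    (hq : ∀ q : Fin N → ℂ, q ≠ 0 → (∃ s ∈ J, eval q s ≠ 0) ∨
      ∃ (f : Fin 3 → MvPolynomial (Fin N) ℂ) (u : Fin 3 → Fin N → ℂ), (∀ k, f k ∈ J) ∧
        (∀ k, eval q (f k) = 0) ∧
        (∀ k l, fderiv ℂ (fun z => eval z (f k)) q (u l) = if k = l then 1 else 0)) :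
    (1 : MvPolynomial (Fin N) ℂ) ∈ J := by
  have h1 : ∀ q : Fin N → ℂ, q ≠ 0 → ∃ s ∈ J, eval q s ≠ 0 := by
    intro q hq0
    rcases hq q hq0 with h | ⟨f, u, hf, h0, hd⟩
    · exact h
    · obtain ⟨t, ht, htJ⟩ := hJ _ _ _ _ (regSeqAt q f u h0 hd) (hf 0) (hf 1) (hf 2)
      exact ⟨t, htJ, ht⟩
  have h2 : ∀ i : Fin N, X i ∈ J.radical := by
    intro i
    rw [← MvPolynomial.vanishingIdeal_zeroLocus_eq_radical (K := ℂ) J, MvPolynomial.mem_vanishingIdeal_iff]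
    intro x hx
    by_cases hx0 : x = 0
    · simp [hx0]
    · obtain ⟨s, hs, hne⟩ := h1 x hx0
      exact absurd (by simpa [MvPolynomial.aeval_eq_eval] using (MvPolynomial.mem_zeroLocus_iff.1 hx) s hs) hne
  have h3 : ∀ i : Fin N, ∃ k, X i ^ k ∈ J := fun i => h2 i
  choose k hk using h3
  let K := ∑ i, k i
  have h4 : ∀ i, X i ^ K ∈ J := fun i =>
    J.pow_mem_of_pow_mem (hk i) (Finset.single_le_sum (f := k) (fun _ _ => Nat.zero_le _) (Finset.mem_univ i))
  obtain ⟨t, ht, htJ⟩ := hJ ⊥ _ _ _ (regSeqGlobal (i0 := (⟨0, by omega⟩ : Fin N)) (i1 := ⟨1, by omega⟩)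
    (i2 := ⟨2, by omega⟩) (by simp) (by simp) (by simp) K) (h4 _) (h4 _) (h4 _)
  rw [Submonoid.mem_bot] at ht
  rwa [← ht]

section Abs
variable {S : Type*} [CommRing S] [IsDomain S] {N : ℕ} {R V : Fin N → S}

theorem lemA (hRV : ∀ p q : S, p • R + q • V = 0 → p = 0 ∧ q = 0)
    {T : Submonoid S} {f1 f2 f3 : S} (H : RegSeq T f1 f2 f3) {W : Fin N → S}
    (h1 : ∃ p q : S, f1 • W = p • R + q • V) (h2 : ∃ p q : S, f2 • W = p • R + q • V) :
    ∃ t ∈ T, ∃ p q : S, t • W = p • R + q • V := by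
  obtain ⟨p, q, e1⟩ := h1
  obtain ⟨p', q', e2⟩ := h2
  obtain ⟨hp, hq⟩ := hRV (f2 * p - f1 * p') (f2 * q - f1 * q') (by
    have : f2 • (f1 • W) = f1 • (f2 • W) := by rw [smul_smul, smul_smul, mul_comm]
    rw [e1, e2] at this
    ext i
    have := congrFun this i
    simp only [Pi.smul_apply, Pi.add_apply, Pi.zero_apply, smul_eq_mul] at this ⊢
    linear_combination this)
  rw [sub_eq_zero] at hp hq
  obtain ⟨t, ht, a, ha⟩ := H.r2 p ⟨p', hp⟩
  obtain ⟨t', ht', b, hb⟩ := H.r2 q ⟨q', hq⟩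
  refine ⟨t * t', T.mul_mem ht ht', t' * a, t * b, ?_⟩
  have : f1 • ((t * t') • W) = f1 • ((t' * a) • R + (t * b) • V) := by
    ext i
    have := congrFun e1 i
    simp only [Pi.smul_apply, Pi.add_apply, smul_eq_mul] at this ⊢
    linear_combination (t * t') * this + t' * R i * ha + t * V i * hb
  exact smul_right_injective _ H.ne this

theorem lemB (hRV : ∀ p q : S, p • R + q • V = 0 → p = 0 ∧ q = 0)
    {ι : Type*} {T : Submonoid S} {f1 f2 f3 : S} (H : RegSeq T f1 f2 f3)
    (B : (Fin N → S) →ₗ[S] (ι → S)) (hR : B R = 0) (hV : B V = 0)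
    (hker : ∀ Y, B Y = 0 → ∃ p q : S, Y = p • R + q • V) (Ω : ι → S)
    (h1 : ∃ Y, f1 • Ω = B Y) (h2 : ∃ Y, f2 • Ω = B Y) (h3 : ∃ Y, f3 • Ω = B Y) :
    ∃ t ∈ T, ∃ Y, t • Ω = B Y := by
  obtain ⟨Y1, e1⟩ := h1
  obtain ⟨Y2, e2⟩ := h2
  obtain ⟨Y3, e3⟩ := h3
  have hk : ∀ (a b : S) (Y Y' : Fin N → S), a • Ω = B Y → b • Ω = B Y' →
      ∃ p q : S, b • Y - a • Y' = p • R + q • V := by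
    intro a b Y Y' h h'
    apply hker
    rw [map_sub, map_smul, map_smul, ← h, ← h', smul_smul, smul_smul, mul_comm, sub_self]
  obtain ⟨p12, q12, e12⟩ := hk _ _ _ _ e1 e2
  obtain ⟨p13, q13, e13⟩ := hk _ _ _ _ e1 e3
  obtain ⟨p23, q23, e23⟩ := hk _ _ _ _ e2 e3
  obtain ⟨hp, hq⟩ := hRV (f3 * p12 - f2 * p13 + f1 * p23) (f3 * q12 - f2 * q13 + f1 * q23) (by
    ext i
    have a1 := congrFun e12 i
    have a2 := congrFun e13 i
    have a3 := congrFun e23 i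
    simp only [Pi.smul_apply, Pi.add_apply, Pi.sub_apply, smul_eq_mul, Pi.zero_apply] at a1 a2 a3 ⊢
    linear_combination - f3 * a1 + f2 * a2 - f1 * a3)
  obtain ⟨t, ht, u, v, h⟩ := H.r3 p12 (-p23) p13 (by linear_combination hp)
  obtain ⟨t', ht', u', v', h'⟩ := H.r3 q12 (-q23) q13 (by linear_combination hq)
  set Z := (t * t') • Y1 - (t' * v) • R - (t * v') • V with hZ
  have hZ2 : ∀ i, f1 ∣ f2 * Z i := by
    intro i
    refine ⟨t * t' * Y2 i + t' * u * R i + t * u' * V i, ?_⟩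
    have a1 := congrFun e12 i
    simp only [hZ, Pi.smul_apply, Pi.add_apply, Pi.sub_apply, smul_eq_mul] at a1 ⊢
    linear_combination (t * t') * a1 + t' * R i * h + t * V i * h'
  choose s hs hsd using fun i => H.r2 _ (hZ2 i)
  have hsP : ∏ i, s i ∈ T := T.prod_mem fun i _ => hs i
  have hdv : ∀ i, f1 ∣ (∏ i, s i) * Z i := fun i =>
    (hsd i).trans (mul_dvd_mul_right (Finset.dvd_prod_of_mem s (Finset.mem_univ i)) _)
  choose Y hY using hdv
  refine ⟨(∏ i, s i) * (t * t'), T.mul_mem hsP (T.mul_mem ht ht'), Y, ?_⟩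
  have hY' : (∏ i, s i) • Z = f1 • Y := funext hY
  have := congrArg B hY'
  rw [map_smul, map_smul, hZ, map_sub, map_sub, map_smul, map_smul, map_smul, hR, hV, ← e1] at this
  apply smul_right_injective _ H.ne
  simp only [smul_zero, sub_zero] at this
  dsimp only
  rw [← this, smul_smul, smul_smul, smul_smul]
  congr 1
  ring
end Abs

end S12

namespace S12
open MvPolynomial

/-- rows `a, b, c, v` -/
def rows {S : Type*} {m : ℕ} (a b c : Fin (m+3) → S) (v : Fin m → Fin (m+3) → S) :
    Fin (m+3) → Fin (m+3) → S :=
  Fin.cons a (Fin.cons b (Fin.cons c v))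

theorem cons3_inj {β : Type*} {m : ℕ} {a b c : β} {v : Fin m → β} (hv : Function.Injective v)
    (hc : c ∉ Set.range v) (hb : b ∉ Set.range v) (ha : a ∉ Set.range v) (hab : a ≠ b) (hac : a ≠ c) (hbc : b ≠ c) :
    Function.Injective (Fin.cons a (Fin.cons b (Fin.cons c v)) : Fin (m+3) → β) := by
  refine Fin.cons_injective_iff.2 ⟨?_, Fin.cons_injective_iff.2 ⟨?_, Fin.cons_injective_iff.2 ⟨hc, hv⟩⟩⟩
  · rw [Fin.range_cons, Fin.range_cons]
    simp only [Set.mem_insert_iff, not_or]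
    exact ⟨hab, hac, ha⟩
  · rw [Fin.range_cons]
    simp only [Set.mem_insert_iff, not_or]
    exact ⟨hbc, hb⟩

theorem sumExtend_inl {ι K W : Type*} [DivisionRing K] [AddCommGroup W] [Module K W] {v : ι → W}
    (hs : LinearIndependent K v) (i : ι) : Module.Basis.sumExtend hs (Sum.inl i) = v i := by
  simp only [Module.Basis.sumExtend, Trans.trans, Module.Basis.reindex_apply, Module.Basis.extend_apply_self]
  rfl

theorem exists_det_ne {m : ℕ} {a b c : Fin (m+3) → ℂ} (h : LinearIndependent ℂ ![a, b, c]) :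
    ∃ v : Fin m → Fin (m+3) → ℂ, Matrix.det (Matrix.of (rows a b c v)) ≠ 0 := by
  let B := Module.Basis.sumExtend h
  have : Finite (Fin 3 ⊕ Module.Basis.sumExtendIndex h) := Module.Finite.finite_basis B
  have : Finite (Module.Basis.sumExtendIndex h) := Finite.of_injective _ (Sum.inr_injective (α := Fin 3))
  letI := Fintype.ofFinite (Module.Basis.sumExtendIndex h)
  have hcard : Fintype.card (Module.Basis.sumExtendIndex h) = m := by
    have := Module.finrank_eq_card_basis B
    rw [Fintype.card_sum, Fintype.card_fin, Module.finrank_fin_fun] at this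
    simp only [Nat.succ_eq_add_one] at this
    omega
  let e := (Fintype.equivFinOfCardEq hcard).symm
  refine ⟨fun i => B (Sum.inr (e i)), ?_⟩
  have h1 : rows a b c (fun i => B (Sum.inr (e i))) =
      B ∘ (Fin.cons (Sum.inl 0) (Fin.cons (Sum.inl 1) (Fin.cons (Sum.inl 2) (fun i => Sum.inr (e i)))) :
        Fin (m+3) → Fin 3 ⊕ Module.Basis.sumExtendIndex h) := by
    funext i
    refine Fin.cases ?_ (fun i => Fin.cases ?_ (fun i => Fin.cases ?_ (fun i => ?_) i) i) i
    · exact (sumExtend_inl h 0).symm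
    · exact (sumExtend_inl h 1).symm
    · exact (sumExtend_inl h 2).symm
    · rfl
  have h2 : LinearIndependent ℂ (rows a b c (fun i => B (Sum.inr (e i)))) := by
    rw [h1]
    refine B.linearIndependent.comp _ (cons3_inj ?_ ?_ ?_ ?_ ?_ ?_ ?_) <;> simp
    exact Sum.inr_injective.comp e.injective
  have h3 := (Matrix.linearIndependent_rows_iff_isUnit (A := Matrix.of (rows a b c (fun i => B (Sum.inr (e i)))))).1 h2
  exact ((Matrix.isUnit_iff_isUnit_det _).1 h3).ne_zero

theorem minor3 {m : ℕ} {a b c : Fin (m+3) → ℂ} (h : ∀ v, Matrix.det (Matrix.of (rows a b c v)) = 0) (i j k : Fin (m+3)) :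
    a i * (b j * c k - b k * c j) - a j * (b i * c k - b k * c i) + a k * (b i * c j - b j * c i) = 0 := by
  have h1 : ¬ LinearIndependent ℂ ![a, b, c] := fun hl => by
    obtain ⟨v, hv⟩ := exists_det_ne hl
    exact hv (h v)
  rw [Fintype.not_linearIndependent_iff] at h1
  obtain ⟨g, hg, l, hl⟩ := h1
  simp only [Fin.sum_univ_three, Matrix.cons_val] at hg
  have hi := congrFun hg i
  have hj := congrFun hg j
  have hk := congrFun hg k
  simp only [Pi.add_apply, Pi.smul_apply, smul_eq_mul, Pi.zero_apply] at hi hj hk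
  apply mul_left_cancel₀ hl
  rw [mul_zero]
  fin_cases l
  · simp only [Fin.zero_eta]
    linear_combination (b j * c k - b k * c j) * hi - (b i * c k - b k * c i) * hj + (b i * c j - b j * c i) * hk
  · simp only [Fin.mk_one]
    linear_combination -(a j * c k - a k * c j) * hi + (a i * c k - a k * c i) * hj - (a i * c j - a j * c i) * hk
  · simp only [Fin.reduceFinMk]
    linear_combination (a j * b k - a k * b j) * hi - (a i * b k - a k * b i) * hj + (a i * b j - a j * b i) * hk

/-- every `M`-form on `ℂ^(M+1)` is a contraction of the volume form -/
theorem form_eq_det {M : ℕ} (Θ : AlternatingMap ℂ (Fin (M+1) → ℂ) ℂ (Fin M)) (u : Fin M → Fin (M+1) → ℂ) :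
    Θ u = Matrix.det (Matrix.of (Fin.cons (fun k : Fin (M+1) => (-1)^(k:ℕ) * Θ (fun i => Pi.single (k.succAbove i) 1)) u
      : Fin (M+1) → Fin (M+1) → ℂ)) := by
  set Y : Fin (M+1) → ℂ := fun k : Fin (M+1) => (-1)^(k:ℕ) * Θ (fun i => Pi.single (k.succAbove i) 1) with hY
  let Δ : AlternatingMap ℂ (Fin (M+1) → ℂ) ℂ (Fin (M+1)) := Matrix.detRowAlternating
  have key : Θ = Δ.curryLeft Y := by
    refine (Pi.basisFun ℂ (Fin (M+1))).ext_alternating fun v hv => ?_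
    have : ∃ k, k ∉ Set.range v := by
      by_contra hcon
      push Not at hcon
      have := Fintype.card_le_of_surjective v hcon
      simp at this
    obtain ⟨k, hk⟩ := this
    have hs : ∀ i, ∃ j, k.succAbove j = v i := fun i => Fin.exists_succAbove_eq (fun h => hk ⟨i, h⟩)
    choose π hπ using hs
    have hπi : Function.Injective π := fun i j h => hv (by rw [← hπ, ← hπ, h])
    let π' : Equiv.Perm (Fin M) := Equiv.ofBijective π (Finite.injective_iff_bijective.1 hπi)
    have e1 : (fun i => Pi.basisFun ℂ (Fin (M+1)) (v i)) =
        (fun i => (Pi.single (k.succAbove i) 1 : Fin (M+1) → ℂ)) ∘ π' := by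
      funext i
      simp [π', hπ]
    rw [e1, AlternatingMap.map_perm, AlternatingMap.map_perm]
    congr 1
    rw [AlternatingMap.curryLeft_apply_apply]
    change _ = Matrix.det (Matrix.of (Matrix.vecCons Y fun i => (Pi.single (k.succAbove i) 1 : Fin (M+1) → ℂ)))
    rw [Matrix.det_succ_row_zero, Finset.sum_eq_single k]
    · have : ((Matrix.of (Matrix.vecCons Y fun i => (Pi.single (k.succAbove i) 1 : Fin (M+1) → ℂ))).submatrix
          Fin.succ k.succAbove) = 1 := by
        ext i j
        simp [Matrix.submatrix_apply, Pi.single_apply, Matrix.one_apply, eq_comm]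
      rw [this, Matrix.det_one, mul_one]
      simp only [Matrix.of_apply, Matrix.cons_val_zero, hY]
      rw [← mul_assoc, ← pow_add, Even.neg_one_pow ⟨_, rfl⟩, one_mul]
    · intro j _ hj
      obtain ⟨l, hl⟩ := Fin.exists_succAbove_eq (x := k) (y := j) (Ne.symm hj)
      rw [Matrix.det_eq_zero_of_column_eq_zero l, mul_zero]
      intro i
      simp [Matrix.submatrix_apply, hl, Pi.single_apply, (Fin.succAbove_ne k i).symm]
    · simp
  have h2 := congrArg (fun F => F u) key
  exact h2

/-- `α ∧ ω` -/
noncomputable def wd {E : Type*} [AddCommGroup E] [Module ℂ E] {m : ℕ} (α : E →ₗ[ℂ] ℂ)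
    (ω : AlternatingMap ℂ E ℂ (Fin m)) : AlternatingMap ℂ E ℂ (Fin (m+1)) :=
  AlternatingMap.alternatizeUncurryFin (α.smulRight ω)

theorem wd_apply {E : Type*} [AddCommGroup E] [Module ℂ E] {m : ℕ} (α : E →ₗ[ℂ] ℂ)
    (ω : AlternatingMap ℂ E ℂ (Fin m)) (v : Fin (m+1) → E) :
    wd α ω v = ∑ i : Fin (m+1), (-1 : ℂ)^(i:ℕ) * (α (v i) * ω (fun j => v (i.succAbove j))) := by
  rw [wd, AlternatingMap.alternatizeUncurryFin_apply]
  refine Finset.sum_congr rfl fun i _ => ?_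
  rcases neg_one_pow_eq_or ℤ (i:ℕ) with h | h <;> rcases neg_one_pow_eq_or ℂ (i:ℕ) with h' | h' <;>
    simp [LinearMap.smulRight_apply] <;> left <;> rfl

section
variable {E : Type*} [AddCommGroup E] [Module ℂ E] {m : ℕ} (ω : AlternatingMap ℂ E ℂ (Fin m)) (α β : E →ₗ[ℂ] ℂ)
  {V R : E} 

theorem wd_cons (hR : ∀ v i, v i = R → ω v = 0) (v : Fin m → E) :
    wd α ω (Fin.cons R v) = α R * ω v := by
  rw [wd_apply, Fin.sum_univ_succ, Finset.sum_eq_zero]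
  · simp
  · intro i _
    obtain ⟨l, hl⟩ := Fin.exists_succAbove_eq (x := (0 : Fin (m+1))) (y := i.succ) (Fin.succ_ne_zero i).symm
    rw [hR _ l (by simp [hl])]; simp

theorem wd_two (hR : ∀ v i, v i = R → ω v = 0) (hV : ∀ v i, v i = V → ω v = 0) (v : Fin (m+1) → E)
    {i j : Fin (m+1)} (hij : i ≠ j) (hi : v i = V) (hj : v j = R) : wd α ω v = 0 := by
  rw [wd_apply]
  refine Finset.sum_eq_zero fun k _ => ?_
  have : ω (fun j => v (k.succAbove j)) = 0 := by
    by_cases h : k = i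
    · subst h
      obtain ⟨l, hl⟩ := Fin.exists_succAbove_eq hij.symm
      exact hR _ l (by simp [hl, hj])
    · obtain ⟨l, hl⟩ := Fin.exists_succAbove_eq (Ne.symm h)
      exact hV _ l (by simp [hl, hi])
  rw [this]; simp

theorem wd_wd (hR : ∀ v i, v i = R → ω v = 0) (hV : ∀ v i, v i = V → ω v = 0) (v : Fin m → E) :
    wd β (wd α ω) (Fin.cons V (Fin.cons R v)) = (β V * α R - β R * α V) * ω v := by
  rw [wd_apply, Fin.sum_univ_succ, Fin.sum_univ_succ, Finset.sum_eq_zero]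
  · have e1 : (fun j : Fin (m+1) => (Fin.cons V (Fin.cons R v) : Fin (m+2) → E) ((0 : Fin (m+2)).succAbove j)) = Fin.cons R v := by
      funext j; simp
    have e2 : (fun j : Fin (m+1) => (Fin.cons V (Fin.cons R v) : Fin (m+2) → E) ((Fin.succ 0 : Fin (m+2)).succAbove j)) = Fin.cons V v := by
      funext j
      refine Fin.cases ?_ (fun j => ?_) j
      · simp
      · rw [Fin.succ_succAbove_succ]; simp
    rw [e1, e2, wd_cons ω α hR, wd_cons ω α hV]
    simp
    ring
  · intro i _
    obtain ⟨l, hl⟩ := Fin.exists_succAbove_eq (x := (0 : Fin (m+2))) (y := i.succ.succ) (Fin.succ_ne_zero _).symm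
    obtain ⟨l', hl'⟩ := Fin.exists_succAbove_eq (x := (1 : Fin (m+2))) (y := i.succ.succ) (by
      rw [← Fin.succ_zero_eq_one]
      exact fun h => (Fin.succ_ne_zero _).symm (Fin.succ_injective _ h))
    rw [wd_two ω α hR hV _ (i := l) (j := l') ?_ ?_ ?_]
    · simp
    · rintro rfl
      rw [hl] at hl'; simp at hl'
    · simp [hl]
    · rw [hl', ← Fin.succ_zero_eq_one]; simp
end

end S12

namespace S12
open MvPolynomial

theorem homog_poly {N : ℕ} (f : (Fin N → ℂ) → ℂ) (hf : AnalyticOnNhd ℂ f univ) (k : ℕ)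
    (hk : ∀ (t : ℂ) z, f (t • z) = t ^ k * f z) : ∃ P : MvPolynomial (Fin N) ℂ, ∀ z, f z = eval z P := by
  have hc : ContDiff ℂ k f := contDiffOn_univ.1 (hf.contDiffOn uniqueDiffOn_univ)
  set A := iteratedFDeriv ℂ k f 0 with hA
  have h1 : ∀ z, (k.factorial : ℂ) * f z = A (fun _ => z) := by
    intro z
    let u : ℂ →L[ℂ] (Fin N → ℂ) := ContinuousLinearMap.toSpanSingleton ℂ z
    have e1 := u.iteratedFDeriv_comp_right hc 0 (i := k) le_rfl
    have e2 : f ∘ u = fun t => f z * t ^ k := by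
      funext t
      simp [u, hk, mul_comm]
    have e3 : iteratedDeriv k (f ∘ u) 0 = f z * k.factorial := by
      rw [e2, iteratedDeriv_const_mul_field, iteratedDeriv_pow]
      simp [Nat.descFactorial_self]
    rw [iteratedDeriv_eq_iteratedFDeriv, e1] at e3
    rw [mul_comm, ← e3]
    simp [u, hA]
  have h2 : ∀ z, A (fun _ => z) = ∑ r : Fin k → Fin N, (∏ i, z (r i)) * A (fun i => Pi.single (r i) 1) := by
    intro z
    have : (fun _ : Fin k => z) = fun _ : Fin k => ∑ j, z j • (Pi.single j 1 : Fin N → ℂ) := by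
      funext _
      exact (pi_eq_sum_univ' z)
    rw [this]
    have := A.toMultilinearMap.map_sum (fun (_ : Fin k) (j : Fin N) => z j • (Pi.single j 1 : Fin N → ℂ))
    refine this.trans (Finset.sum_congr rfl fun r _ => ?_)
    rw [MultilinearMap.map_smul_univ]
    rfl
  refine ⟨∑ r : Fin k → Fin N, C ((k.factorial : ℂ)⁻¹ * A (fun i => Pi.single (r i) 1)) * ∏ i, X (r i), fun z => ?_⟩
  have hk0 : (k.factorial : ℂ) ≠ 0 := by exact_mod_cast k.factorial_ne_zero
  apply mul_left_cancel₀ hk0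
  rw [h1, h2]
  simp only [map_sum, map_mul, map_prod, eval_X, eval_C, Finset.mul_sum]
  refine Finset.sum_congr rfl fun r _ => ?_
  field_simp

/-- evaluation of a polynomial vector -/
noncomputable def ev {N : ℕ} {ι : Type*} (z : Fin N → ℂ) (Y : ι → MvPolynomial (Fin N) ℂ) : ι → ℂ := fun i => eval z (Y i)

section
variable {m : ℕ}

/-- constant vectors -/
noncomputable def cst (v : Fin m → Fin (m+3) → ℂ) : Fin m → Fin (m+3) → MvPolynomial (Fin (m+3)) ℂ :=
  fun i j => C (v i j)

noncomputable def BB (V : Fin (m+3) → MvPolynomial (Fin (m+3)) ℂ) :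
    (Fin (m+3) → MvPolynomial (Fin (m+3)) ℂ) →ₗ[MvPolynomial (Fin (m+3)) ℂ]
      ((Fin m → Fin (m+3) → ℂ) → MvPolynomial (Fin (m+3)) ℂ) :=
  LinearMap.pi fun v => (Matrix.detRowAlternating (R := MvPolynomial (Fin (m+3)) ℂ) (n := Fin (m+3))).toMultilinearMap.toLinearMap
    (rows 0 V X (cst v)) 0

theorem BB_apply (V Y : Fin (m+3) → MvPolynomial (Fin (m+3)) ℂ) (v) :
    BB V Y v = Matrix.det (Matrix.of (rows Y V X (cst v))) := by
  have : rows Y V X (cst v) = Function.update (rows 0 V X (cst v)) 0 Y := by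
    rw [rows, rows, Fin.update_cons_zero]
  rw [this]
  rfl

theorem eval_BB (V Y : Fin (m+3) → MvPolynomial (Fin (m+3)) ℂ) (v) (z : Fin (m+3) → ℂ) :
    eval z (BB V Y v) = Matrix.det (Matrix.of (rows (ev z Y) (ev z V) z v)) := by
  rw [BB_apply, RingHom.map_det]
  congr 1
  ext i j
  refine Fin.cases ?_ (fun i => Fin.cases ?_ (fun i => Fin.cases ?_ (fun i => ?_) i) i) i
  · rfl
  · rfl
  · exact eval_X j
  · exact eval_C _

theorem BB_R (V : Fin (m+3) → MvPolynomial (Fin (m+3)) ℂ) : BB V X = 0 := by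
  funext v
  rw [BB_apply]
  exact Matrix.det_zero_of_row_eq (i := 0) (j := Fin.succ (Fin.succ 0)) (Fin.succ_ne_zero _).symm rfl

theorem BB_V (V : Fin (m+3) → MvPolynomial (Fin (m+3)) ℂ) : BB V V = 0 := by
  funext v
  rw [BB_apply]
  exact Matrix.det_zero_of_row_eq (i := 0) (j := 1) (by simp) rfl

noncomputable def mnr (V : Fin (m+3) → MvPolynomial (Fin (m+3)) ℂ) (i j : Fin (m+3)) : MvPolynomial (Fin (m+3)) ℂ :=
  X i * V j - X j * V i

/-- ideal of minors -/
noncomputable def I2 (V : Fin (m+3) → MvPolynomial (Fin (m+3)) ℂ) : Ideal (MvPolynomial (Fin (m+3)) ℂ) :=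
  Ideal.span (Set.range fun p : Fin (m+3) × Fin (m+3) => mnr V p.1 p.2)

/-- the geometric hypothesis -/
def Good (V : Fin (m+3) → MvPolynomial (Fin (m+3)) ℂ) : Prop :=
  ∀ q : Fin (m+3) → ℂ, q ≠ 0 → (∃ s ∈ I2 V, eval q s ≠ 0) ∨
      ∃ (f : Fin 3 → MvPolynomial (Fin (m+3)) ℂ) (u : Fin 3 → Fin (m+3) → ℂ), (∀ k, f k ∈ I2 V) ∧
        (∀ k, eval q (f k) = 0) ∧
        (∀ k l, fderiv ℂ (fun z => eval z (f k)) q (u l) = if k = l then 1 else 0)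

theorem Good.one_mem {V : Fin (m+3) → MvPolynomial (Fin (m+3)) ℂ} (h : Good V) (J : Ideal (MvPolynomial (Fin (m+3)) ℂ))
    (hJ : ∀ (T : Submonoid (MvPolynomial (Fin (m+3)) ℂ)) (f1 f2 f3 : MvPolynomial (Fin (m+3)) ℂ),
      RegSeq T f1 f2 f3 → f1 ∈ J → f2 ∈ J → f3 ∈ J → ∃ t ∈ T, t ∈ J)
    (hm : ∀ i j, mnr V i j ∈ J) : (1 : MvPolynomial (Fin (m+3)) ℂ) ∈ J := by
  have hle : I2 V ≤ J := Ideal.span_le.2 (by rintro _ ⟨p, rfl⟩; exact hm _ _)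
  refine one_mem_of (by omega) J hJ fun q hq => ?_
  rcases h q hq with ⟨s, hs, h⟩ | ⟨f, u, hf, h⟩
  · exact Or.inl ⟨s, hle hs, h⟩
  · exact Or.inr ⟨f, u, fun k => hle (hf k), h⟩

theorem Good.indep {V : Fin (m+3) → MvPolynomial (Fin (m+3)) ℂ} (h : Good V) (p q : MvPolynomial (Fin (m+3)) ℂ)
    (e : p • X + q • V = 0) : p = 0 ∧ q = 0 := by
  have hne : ∃ i j, mnr V i j ≠ 0 := by
    by_contra hcon
    push Not at hcon
    have h0 : I2 V = ⊥ := by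
      rw [I2, Ideal.span_eq_bot]
      rintro _ ⟨p, rfl⟩; exact hcon _ _
    rcases h (fun _ => 1) (fun h => one_ne_zero (congrFun h 0)) with ⟨s, hs, h⟩ | ⟨f, u, hf, _, h⟩
    · rw [h0, Ideal.mem_bot] at hs
      simp [hs] at h
    · have := hf 0
      rw [h0, Ideal.mem_bot] at this
      have h1 := h 0 0
      simp [this] at h1
  obtain ⟨i, j, hij⟩ := hne
  have ei := congrFun e i
  have ej := congrFun e j
  simp only [Pi.add_apply, Pi.smul_apply, smul_eq_mul, Pi.zero_apply] at ei ej
  constructor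
  · apply mul_right_cancel₀ hij
    rw [mnr]; linear_combination V j * ei - V i * ej
  · apply mul_right_cancel₀ hij
    rw [mnr]; linear_combination - X j * ei + X i * ej

theorem Good.ker {V : Fin (m+3) → MvPolynomial (Fin (m+3)) ℂ} (h : Good V) (Y) (hY : BB V Y = 0) :
    ∃ p q : MvPolynomial (Fin (m+3)) ℂ, Y = p • X + q • V := by
  let J : Ideal (MvPolynomial (Fin (m+3)) ℂ) :=
    Submodule.comap (LinearMap.toSpanSingleton _ _ Y) (Submodule.span _ {X, V})
  have hJ : ∀ s, s ∈ J ↔ ∃ p q : MvPolynomial (Fin (m+3)) ℂ, s • Y = p • X + q • V := by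
    intro s
    simp only [J, Submodule.mem_comap, LinearMap.toSpanSingleton_apply, Submodule.mem_span_pair, eq_comm]
  have := h.one_mem J (fun T f1 f2 f3 H h1 h2 h3 => by
    simp only [hJ] at h1 h2 ⊢
    exact lemA h.indep H h1 h2) (fun i j => by
    rw [hJ]
    refine ⟨Y i * V j - Y j * V i, X i * Y j - X j * Y i, ?_⟩
    funext k
    refine MvPolynomial.funext fun z => ?_
    have hz := minor3 (a := ev z Y) (b := ev z V) (c := z) (fun v => by
      rw [← eval_BB, hY]; simp) i j k
    simp only [ev] at hz
    simp only [mnr, Pi.smul_apply, Pi.add_apply, smul_eq_mul, map_mul, map_add, map_sub, eval_X]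
    linear_combination -hz)
  rw [hJ] at this
  simpa using this

theorem wd_poly {N k : ℕ} (ω : (Fin N → ℂ) → AlternatingMap ℂ (Fin N → ℂ) ℂ (Fin k))
    (h : ∀ v, ∃ P : MvPolynomial (Fin N) ℂ, ∀ z, ω z v = eval z P) (α : (Fin N → ℂ) →ₗ[ℂ] ℂ) (v) :
    ∃ P : MvPolynomial (Fin N) ℂ, ∀ z, wd α (ω z) v = eval z P := by
  choose P hP using h
  refine ⟨∑ i : Fin (k+1), C ((-1 : ℂ)^(i:ℕ)) * (C (α (v i)) * P (fun j => v (i.succAbove j))), fun z => ?_⟩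
  rw [wd_apply, map_sum]
  refine Finset.sum_congr rfl fun i _ => ?_
  rw [hP, map_mul, map_mul, eval_C, eval_C]

theorem core {V : Fin (m+3) → MvPolynomial (Fin (m+3)) ℂ} (h : Good V)
    (ω : (Fin (m+3) → ℂ) → AlternatingMap ℂ (Fin (m+3) → ℂ) ℂ (Fin m))
    (hω : ∀ v, ∃ P : MvPolynomial (Fin (m+3)) ℂ, ∀ z, ω z v = eval z P)
    (hR : ∀ z v i, v i = z → ω z v = 0) (hV : ∀ z v i, v i = ev z V → ω z v = 0) :
    ∃ Y : Fin (m+3) → MvPolynomial (Fin (m+3)) ℂ, ∀ z v,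
      ω z v = Matrix.det (Matrix.of (rows (ev z Y) (ev z V) z v)) := by
  have hω' := hω
  choose Ω hΩ using hω
  let J : Ideal (MvPolynomial (Fin (m+3)) ℂ) :=
    Submodule.comap (LinearMap.toSpanSingleton _ _ Ω) (LinearMap.range (BB V))
  have hJ : ∀ s, s ∈ J ↔ ∃ Y, s • Ω = BB V Y := by
    intro s
    simp only [J, Submodule.mem_comap, LinearMap.toSpanSingleton_apply, LinearMap.mem_range, eq_comm]
  have := h.one_mem J (fun T f1 f2 f3 H h1 h2 h3 => by
    simp only [hJ] at h1 h2 h3 ⊢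
    exact lemB h.indep H (BB V) (BB_R V) (BB_V V) h.ker Ω h1 h2 h3) (fun i j => by
    rw [hJ]
    have hT := wd_poly _ (wd_poly ω hω' (LinearMap.proj i)) (LinearMap.proj j)
    choose T hT using hT
    refine ⟨fun k => C ((-1)^(k:ℕ)) * T (fun l => Pi.single (k.succAbove l) 1), ?_⟩
    funext v
    refine MvPolynomial.funext fun z => ?_
    rw [eval_BB]
    have e1 := wd_wd (ω z) (LinearMap.proj i) (LinearMap.proj j) (V := ev z V) (R := z) (hR z) (hV z) v
    rw [form_eq_det] at e1
    have e2 : (ev z fun k : Fin (m+3) => C ((-1)^(k:ℕ)) * T (fun l => Pi.single (k.succAbove l) 1)) =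
      fun k : Fin (m+3) => (-1)^(k:ℕ) * wd (LinearMap.proj j) (wd (LinearMap.proj i) (ω z)) (fun l => Pi.single (k.succAbove l) 1) := by
      funext k
      rw [hT]; simp only [ev, map_mul, eval_C]
    rw [e2, rows]
    refine Eq.trans ?_ e1.symm
    simp only [LinearMap.proj_apply, ev, Pi.smul_apply, smul_eq_mul, map_mul, mnr, map_sub, eval_X, ← hΩ]
    ring)
  rw [hJ] at this
  obtain ⟨Y, hY⟩ := this
  refine ⟨Y, fun z v => ?_⟩
  rw [← eval_BB, ← hY, hΩ, one_smul]
end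

end S12

namespace S12
open MvPolynomial

section
variable {m : ℕ}

theorem three_lift {E F : Type*} [AddCommGroup E] [Module ℂ E] [AddCommGroup F] [Module ℂ F]
    [FiniteDimensional ℂ F] (M : E →ₗ[ℂ] F) (W : Submodule ℂ E)
    (h : 3 ≤ Module.finrank ℂ (Submodule.map M W)) :
    ∃ (u : Fin 3 → E) (lam : Fin 3 → F →ₗ[ℂ] ℂ), (∀ k, u k ∈ W) ∧
      ∀ k l, lam k (M (u l)) = if k = l then 1 else 0 := by
  obtain ⟨g, hg⟩ := exists_linearIndependent_of_le_finrank h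
  have hg' : LinearIndependent ℂ (fun k => (g k : F)) :=
    hg.map' (Submodule.subtype _) (Submodule.ker_subtype _)
  have : ∀ k, ∃ u ∈ W, M u = g k := fun k => (g k).2
  choose u hu hMu using this
  refine ⟨u, fun k => (Module.Basis.sumExtend hg').coord (Sum.inl k), hu, fun k l => ?_⟩
  rw [hMu, ← sumExtend_inl hg' l, Module.Basis.coord_apply, Module.Basis.repr_self]
  by_cases hkl : k = l
  · subst hkl
    simp
  · rw [Finsupp.single_eq_of_ne, if_neg hkl]
    intro h
    exact hkl (Sum.inl_injective h)

theorem good_of (Vp : Fin (m+3) → MvPolynomial (Fin (m+3)) ℂ) (V : (Fin (m+3) → ℂ) → (Fin (m+3) → ℂ))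
    (hV : ∀ z, V z = ev z Vp)
    (hd : ∀ z, DifferentiableAt ℂ V z)
    (hrk : ∀ q, q ≠ 0 → V q ∈ Submodule.span ℂ {q} → ∃ ℓ : (Fin (m+3) → ℂ) →ₗ[ℂ] ℂ, ℓ q = 1 ∧
      3 ≤ Module.finrank ℂ (Submodule.map
        ((fderiv ℂ V q).toLinearMap - LinearMap.smulRight (ℓ ∘ₗ (fderiv ℂ V q).toLinearMap) q
          - ℓ (V q) • LinearMap.id) (LinearMap.ker ℓ))) : Good Vp := by
  intro q hq
  have hVi : ∀ z i, eval z (Vp i) = V z i := fun z i => by rw [hV]; rfl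
  by_cases hs : V q ∈ Submodule.span ℂ {q}
  · right
    obtain ⟨ℓ, hl, h3⟩ := hrk q hq hs
    obtain ⟨u, lam, hu, hlam⟩ := three_lift _ _ h3
    let f : Fin 3 → MvPolynomial (Fin (m+3)) ℂ := fun k =>
      ∑ i, C (lam k (Pi.single i 1)) * ∑ j, C (ℓ (Pi.single j 1)) * mnr Vp j i
    have hlin : ∀ (φ : (Fin (m+3) → ℂ) →ₗ[ℂ] ℂ) (z : Fin (m+3) → ℂ), φ z = ∑ i, φ (Pi.single i 1) * z i := by
      intro φ z
      conv_lhs => rw [pi_eq_sum_univ' z]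
      rw [map_sum]
      refine Finset.sum_congr rfl fun i _ => ?_
      rw [map_smul, smul_eq_mul, mul_comm]
    have hev : ∀ k z, eval z (f k) = lam k (ℓ z • V z - ℓ (V z) • z) := by
      intro k z
      rw [hlin (lam k)]
      simp only [f, map_sum, map_mul, eval_C, mnr, map_sub, eval_X, hVi]
      refine Finset.sum_congr rfl fun i _ => ?_
      congr 1
      rw [Pi.sub_apply, Pi.smul_apply, Pi.smul_apply, smul_eq_mul, smul_eq_mul, hlin ℓ z, hlin ℓ (V z),
        Finset.sum_mul, Finset.sum_mul, ← Finset.sum_sub_distrib]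
      refine Finset.sum_congr rfl fun j _ => ?_
      ring
    refine ⟨f, u, fun k => ?_, fun k => ?_, fun k l => ?_⟩
    · refine Ideal.sum_mem _ fun i _ => Ideal.mul_mem_left _ _ (Ideal.sum_mem _ fun j _ => Ideal.mul_mem_left _ _ ?_)
      exact Ideal.subset_span ⟨(j, i), rfl⟩
    · obtain ⟨c, hc⟩ := Submodule.mem_span_singleton.1 hs
      rw [hev, ← hc, hl, map_smul, hl]
      simp
    · have e : (fun z => eval z (f k)) = fun z => (lam k).toContinuousLinearMap
          (ℓ.toContinuousLinearMap z • V z - ℓ.toContinuousLinearMap (V z) • z) := funext (hev k)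
      have h1 : HasFDerivAt V (fderiv ℂ V q) q := (hd q).hasFDerivAt
      have h2 : HasFDerivAt (fun z => ℓ.toContinuousLinearMap z) ℓ.toContinuousLinearMap q :=
        ℓ.toContinuousLinearMap.hasFDerivAt
      have h3' : HasFDerivAt (fun z => ℓ.toContinuousLinearMap (V z))
          (ℓ.toContinuousLinearMap.comp (fderiv ℂ V q)) q :=
        ℓ.toContinuousLinearMap.hasFDerivAt.comp q h1
      have h4 : ∃ A : (Fin (m+3) → ℂ) →L[ℂ] (Fin (m+3) → ℂ), HasFDerivAt (fun z =>
          ℓ.toContinuousLinearMap z • V z - ℓ.toContinuousLinearMap (V z) • z) A q ∧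
          ∀ x, A x = ℓ q • fderiv ℂ V q x + ℓ x • V q - (ℓ (V q) • x + ℓ (fderiv ℂ V q x) • q) :=
        ⟨_, (h2.smul h1).sub (h3'.smul (hasFDerivAt_id q)), fun x => rfl⟩
      obtain ⟨A, h4, hA⟩ := h4
      have h5 : HasFDerivAt (fun z => eval z (f k)) ((lam k).toContinuousLinearMap.comp A) q := by
        rw [e]
        exact (lam k).toContinuousLinearMap.hasFDerivAt.comp q h4
      rw [h5.fderiv, ← hlam k l]
      have hul : ℓ (u l) = 0 := hu l
      show lam k (A (u l)) = _
      rw [hA, hl, hul]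
      congr 1
      simp
      abel
  · left
    by_contra hcon
    push Not at hcon
    apply hs
    obtain ⟨i, hi⟩ := Function.ne_iff.1 hq
    have hi : q i ≠ 0 := hi
    rw [Submodule.mem_span_singleton]
    refine ⟨V q i / q i, funext fun j => ?_⟩
    have := hcon (mnr Vp i j) (Ideal.subset_span ⟨(i, j), rfl⟩)
    simp only [mnr, map_sub, map_mul, eval_X, hVi] at this
    rw [Pi.smul_apply, smul_eq_mul]
    field_simp
    linear_combination -this

theorem eval_smul_homog {N : ℕ} (P : MvPolynomial (Fin N) ℂ) (k : ℕ) (t : ℂ) (z : Fin N → ℂ) :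
    eval (t • z) (homogeneousComponent k P) = t ^ k * eval z (homogeneousComponent k P) := by
  have h := homogeneousComponent_isHomogeneous k P
  rw [eval_eq, eval_eq, Finset.mul_sum]
  refine Finset.sum_congr rfl fun d hd => ?_
  have hd' := h (mem_support_iff.1 hd)
  have : ∏ i ∈ d.support, (t • z) i ^ d i = t ^ k * ∏ i ∈ d.support, z i ^ d i := by
    simp only [Pi.smul_apply, smul_eq_mul, mul_pow]
    rw [Finset.prod_mul_distrib, Finset.prod_pow_eq_pow_sum]
    congr 2
    rw [← hd', Finsupp.weight_apply, Finsupp.sum]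
    simp
  rw [this]
  ring

theorem sum_comp {N : ℕ} (P : MvPolynomial (Fin N) ℂ) (K : ℕ) (hK : P.totalDegree < K) :
    ∑ k ∈ Finset.range K, homogeneousComponent k P = P := by
  rw [← Finset.sum_subset (s₁ := Finset.range (P.totalDegree + 1)), sum_homogeneousComponent]
  · intro x hx
    simp only [Finset.mem_range] at *
    omega
  · intro x _ hx
    simp only [Finset.mem_range] at *
    exact homogeneousComponent_eq_zero _ _ (by omega)

theorem det_lin (b z : Fin (m+3) → ℂ) (v) : ∃ φ : (Fin (m+3) → ℂ) →ₗ[ℂ] ℂ,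
    ∀ a, φ a = Matrix.det (Matrix.of (rows a b z v)) := by
  refine ⟨(Matrix.detRowAlternating (R := ℂ) (n := Fin (m+3))).toMultilinearMap.toLinearMap
    (rows 0 b z v) 0, fun a => ?_⟩
  have : rows a b z v = Function.update (rows 0 b z v) 0 a := by
    rw [rows, rows, Fin.update_cons_zero]
  rw [this]
  rfl

theorem det_smul2 (a b z : Fin (m+3) → ℂ) (v) (s t : ℂ) :
    Matrix.det (Matrix.of (rows a (s • b) (t • z) v)) = s * t * Matrix.det (Matrix.of (rows a b z v)) := by
  have h1 : rows a (s • b) (t • z) v = Function.update (rows a b (t • z) v) 1 (s • b) := by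
    funext i
    refine Fin.cases rfl (fun i => Fin.cases rfl (fun i => ?_) i) i
    rw [Function.update_of_ne]
    · rfl
    · intro h
      have := congrArg Fin.val h
      simp at this
  have h2 : rows a b (t • z) v = Function.update (rows a b z v) 2 (t • z) := by
    funext i
    refine Fin.cases rfl (fun i => Fin.cases rfl (fun i => Fin.cases rfl (fun i => ?_) i) i) i
    rw [Function.update_of_ne]
    · rfl
    · intro h
      have := congrArg Fin.val h
      rw [show ((2 : Fin (m+3)) : ℕ) = 2 from rfl] at this
      simp at this
  have e1 : Function.update (rows a b (t • z) v) 1 b = rows a b (t • z) v := Function.update_eq_self 1 _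
  have e2 : Function.update (rows a b z v) 2 z = rows a b z v := Function.update_eq_self 2 (rows a b z v)
  rw [h1]
  refine (Matrix.det_updateRow_smul (Matrix.of (rows a b (t • z) v)) 1 s b).trans ?_
  rw [mul_assoc]
  congr 1
  refine (congrArg (fun x => Matrix.det (Matrix.of x)) e1).trans ?_
  rw [h2]
  refine (Matrix.det_updateRow_smul (Matrix.of (rows a b z v)) 2 t z).trans ?_
  congr 1
  exact congrArg (fun x => Matrix.det (Matrix.of x)) e2

theorem homog_pick (Y : Fin (m+3) → MvPolynomial (Fin (m+3)) ℂ) (V : (Fin (m+3) → ℂ) → (Fin (m+3) → ℂ))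
    (ω : (Fin (m+3) → ℂ) → (Fin m → Fin (m+3) → ℂ) → ℂ) (d dV : ℕ)
    (hω : ∀ (t : ℂ) z v, ω (t • z) v = t ^ (d+1) * ω z v) (hV : ∀ (t : ℂ) z, V (t • z) = t ^ dV • V z)
    (h : ∀ z v, ω z v = Matrix.det (Matrix.of (rows (ev z Y) (V z) z v))) :
    ∃ (Y' : Fin (m+3) → MvPolynomial (Fin (m+3)) ℂ) (e : ℕ), (∀ (t : ℂ) z, ev (t • z) Y' = t ^ e • ev z Y') ∧
      ∀ z v, ω z v = Matrix.det (Matrix.of (rows (ev z Y') (V z) z v)) := by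
  set K := (∑ i, (Y i).totalDegree) + 1 + d + dV with hK
  let Yc : ℕ → Fin (m+3) → MvPolynomial (Fin (m+3)) ℂ := fun k i => homogeneousComponent k (Y i)
  have hYc : ∀ k (t : ℂ) z, ev (t • z) (Yc k) = t ^ k • ev z (Yc k) := by
    intro k t z
    funext i
    exact eval_smul_homog (Y i) k t z
  have hsum : ∀ z, ev z Y = ∑ k ∈ Finset.range K, ev z (Yc k) := by
    intro z
    funext i
    rw [Finset.sum_apply]
    show eval z (Y i) = ∑ k ∈ Finset.range K, eval z (homogeneousComponent k (Y i))
    rw [← map_sum, sum_comp]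
    have := Finset.single_le_sum (f := fun i => (Y i).totalDegree) (fun _ _ => Nat.zero_le _) (Finset.mem_univ i)
    have : (Y i).totalDegree ≤ ∑ i, (Y i).totalDegree := this
    omega
  have key : ∀ z v, ω z v = if dV ≤ d then Matrix.det (Matrix.of (rows (ev z (Yc (d - dV))) (V z) z v)) else 0 := by
    intro z v
    let δ : ℕ → ℂ := fun k => Matrix.det (Matrix.of (rows (ev z (Yc k)) (V z) z v))
    have hpoly : Polynomial.monomial (d+1) (ω z v) = ∑ k ∈ Finset.range K, Polynomial.monomial (dV + 1 + k) (δ k) := by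
      refine Polynomial.funext fun t => ?_
      rw [Polynomial.eval_monomial, Polynomial.eval_finsetSum]
      simp only [Polynomial.eval_monomial]
      rw [mul_comm, ← hω, h, hV, det_smul2]
      obtain ⟨φ, hφ⟩ := det_lin (V z) z v
      rw [← hφ, hsum, map_sum, Finset.mul_sum]
      refine Finset.sum_congr rfl fun k _ => ?_
      rw [hYc, map_smul, hφ, smul_eq_mul]
      simp only [δ]
      ring
    have hc := congrArg (fun p => Polynomial.coeff p (d+1)) hpoly
    simp only [Polynomial.coeff_monomial, Polynomial.finsetSum_coeff, if_true] at hc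
    rw [hc]
    split_ifs with hle
    · rw [Finset.sum_eq_single (d - dV)]
      · rw [if_pos (by omega)]
      · intro b _ hb
        rw [if_neg (by omega)]
      · intro hb
        simp only [Finset.mem_range] at hb
        omega
    · refine Finset.sum_eq_zero fun k _ => ?_
      rw [if_neg (by omega)]
  by_cases hle : dV ≤ d
  · exact ⟨Yc (d - dV), d - dV, hYc _, fun z v => by rw [key, if_pos hle]⟩
  · refine ⟨0, 0, fun t z => ?_, fun z v => ?_⟩
    · funext i
      simp [ev]
    · rw [key, if_neg hle]
      obtain ⟨φ, hφ⟩ := det_lin (V z) z v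
      rw [← hφ]
      have : ev z (0 : Fin (m+3) → MvPolynomial (Fin (m+3)) ℂ) = 0 := by
        funext i
        simp [ev]
      rw [this, map_zero]

theorem ev_analytic (Y : Fin (m+3) → MvPolynomial (Fin (m+3)) ℂ) :
    AnalyticOnNhd ℂ (fun z : Fin (m+3) → ℂ => ev z Y) univ := by
  intro z _
  rw [analyticAt_pi_iff]
  intro i
  exact AnalyticOnNhd.eval_mvPolynomial (Y i) z (mem_univ _)

theorem main_abs (ω : (Fin (m+3) → ℂ) → AlternatingMap ℂ (Fin (m+3) → ℂ) ℂ (Fin m))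
    (V : (Fin (m+3) → ℂ) → (Fin (m+3) → ℂ)) (d dV : ℕ)
    (hωa : ∀ v, AnalyticOnNhd ℂ (fun z => ω z v) univ) (hVa : AnalyticOnNhd ℂ V univ)
    (hω : ∀ (t : ℂ) z v, ω (t • z) v = t ^ (d+1) * ω z v) (hV : ∀ (t : ℂ) z, V (t • z) = t ^ dV • V z)
    (hR : ∀ z v i, v i = z → ω z v = 0) (hT : ∀ z v i, v i = V z → ω z v = 0)
    (hrk : ∀ q, q ≠ 0 → V q ∈ Submodule.span ℂ {q} → ∃ ℓ : (Fin (m+3) → ℂ) →ₗ[ℂ] ℂ, ℓ q = 1 ∧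
      3 ≤ Module.finrank ℂ (Submodule.map
        ((fderiv ℂ V q).toLinearMap - LinearMap.smulRight (ℓ ∘ₗ (fderiv ℂ V q).toLinearMap) q
          - ℓ (V q) • LinearMap.id) (LinearMap.ker ℓ))) :
    ∃ (Y : (Fin (m+3) → ℂ) → (Fin (m+3) → ℂ)) (e : ℕ), AnalyticOnNhd ℂ Y univ ∧
      (∀ (t : ℂ) z, Y (t • z) = t ^ e • Y z) ∧
      ∀ z v, ω z v = Matrix.det (Matrix.of (rows (Y z) (V z) z v)) := by
  have h1 : ∀ v, ∃ P : MvPolynomial (Fin (m+3)) ℂ, ∀ z, ω z v = eval z P := fun v =>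
    homog_poly (fun z => ω z v) (hωa v) (d+1) fun t z => hω t z v
  have h2 : ∀ i, ∃ P : MvPolynomial (Fin (m+3)) ℂ, ∀ z, V z i = eval z P := fun i =>
    homog_poly (fun z => V z i) (fun z hz => analyticAt_pi_iff.1 (hVa z hz) i) dV fun t z => by
      rw [hV]; rfl
  choose Vp hVp using h2
  have hVe : ∀ z, V z = ev z Vp := fun z => funext fun i => hVp i z
  have hG : Good Vp := good_of Vp V hVe (fun z => (hVa z (mem_univ _)).differentiableAt) hrk
  obtain ⟨Y, hY⟩ := core hG ω h1 hR (fun z v i h => hT z v i (by rw [h, hVe]))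
  obtain ⟨Y', e, hY', hd⟩ := homog_pick Y V (fun z v => ω z v) d dV hω hV (fun z v => by rw [hVe, hY])
  exact ⟨fun z => ev z Y', e, ev_analytic Y', hY', hd⟩

theorem rows_swap (a b z : Fin (m+3) → ℂ) (v) :
    Matrix.det (Matrix.of (rows a b z v)) = - Matrix.det (Matrix.of (rows b a z v)) := by
  have h := (Matrix.detRowAlternating (R := ℂ) (n := Fin (m+3))).map_swap (rows b a z v)
    (i := 0) (j := 1) (by simp)
  have e : rows a b z v = rows b a z v ∘ Equiv.swap (0 : Fin (m+3)) 1 := by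
    funext i
    refine Fin.cases ?_ (fun i => Fin.cases ?_ (fun i => ?_) i) i
    · simp; rfl
    · rw [Function.comp_apply, show Fin.succ (0 : Fin (m+2)) = 1 from rfl, Equiv.swap_apply_right]
      rfl
    · rw [Function.comp_apply, Equiv.swap_apply_of_ne_of_ne]
      · rfl
      · intro h
        have := congrArg Fin.val h
        simp at this
      · intro h
        have := congrArg Fin.val h
        simp at this
  rw [e]
  exact h

theorem append_rows (a b z : Fin (m+3) → ℂ) (v : Fin m → Fin (m+3) → ℂ) (h : m + 3 = 3 + m) (i) :
    Fin.append ![a, b, z] v (Fin.cast h i) = rows a b z v i := by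
  refine Fin.cases ?_ (fun i => Fin.cases ?_ (fun i => Fin.cases ?_ (fun i => ?_) i) i) i
  · exact Fin.append_left ![a, b, z] v 0
  · exact Fin.append_left ![a, b, z] v 1
  · exact Fin.append_left ![a, b, z] v 2
  · have : Fin.cast h i.succ.succ.succ = Fin.natAdd 3 i := by
      ext
      simp
      omega
    rw [this, Fin.append_right]
    rfl

theorem det_analytic (Y : (Fin (m+3) → ℂ) → (Fin (m+3) → ℂ)) (hY : AnalyticOnNhd ℂ Y univ)
    (w : Fin (m+2) → Fin (m+3) → ℂ) (q : Fin (m+3) → ℂ) :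
    AnalyticAt ℂ (fun z => (Matrix.detRowAlternating (R := ℂ) (n := Fin (m+3))).curryLeft (Y z) w) q := by
  let φ : (Fin (m+3) → ℂ) →ₗ[ℂ] ℂ :=
    { toFun := fun y => (Matrix.detRowAlternating (R := ℂ) (n := Fin (m+3))).curryLeft y w
      map_add' := fun x y => by rw [map_add]; rfl
      map_smul' := fun c y => by rw [map_smul]; rfl }
  exact (φ.toContinuousLinearMap.analyticAt (Y q)).comp (hY q (mem_univ q))

end

end S12

/-- Theorem 4.8: Let `D` be a two-dimensional distribution on `ℙⁿ`,
`n ≥ 3` (not necessarily with locally free tangent sheaf), and `G` a one-dimensional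
foliation tangent to `D` with linear rank at least `3`. Then `G` locally divides `D` at
every point; in particular `T_D` splits. -/
theorem statement_12 (n : ℕ) (hn : 3 ≤ n) (D : ProjDist n 2) (G : ProjFol1 n)
    (htan : PTangent G D) (hrk : PLinRankGE G 3) :
    (∀ q : Cn (n + 1), q ≠ 0 → PLocDividesAt G D q) ∧ PSplits (by omega) D := by
  obtain ⟨m, rfl⟩ : ∃ m, n = m + 2 := ⟨n - 2, by omega⟩
  obtain ⟨Y, e, hYa, hYh, hY⟩ := S12.main_abs (m := m) D.ω G.V D.d G.d D.hol G.hol D.homog G.homog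
    D.radial htan (fun q hq hs => hrk q ⟨hq, hs⟩)
  refine ⟨fun q _ => ⟨fun z => (Matrix.detRowAlternating (R := ℂ) (n := Fin (m+3))).curryLeft (Y z),
    fun w => S12.det_analytic Y hYa w q, Filter.Eventually.of_forall fun z v => hY z v⟩, ?_⟩
  refine ⟨G.V, Y, G.d, e, -1, by simp, G.hol, hYa, G.homog, hYh, fun z v => ?_⟩
  refine (hY z v).trans ?_
  rw [S12.rows_swap, neg_one_mul]
  congr 2
  ext i j
  exact congrFun (S12.append_rows (G.V z) (Y z) z v (by omega) i).symm j
end
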